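/- Let G be a graph with z ∈ V(G), let k ≥ 2 be an integer, and let f: V(G) → Z_k be a mapping compatible with G. If G is (m+m0+4k−4)-tree-connected, then G has an m-tree-connected f-factor H such that the complement of H in G is m0-tree-connected and d_H(v) ≤ d_G(v) − (k−1) for each vertex v ≠ z. If G is bipartite, then the hypothesis can be weakened to G being (m+m0+2k−2)-tree-connected. -/

import Mathlib

open Finset

variable {V E : Type*}

/-- Degree of vertex `v` in the multigraph whose edge set is `S`
(the ambient multigraph is given by the endpoint map `ends`); a loop counts twice. -/
def mdeg [DecidableEq V] (ends : E → V × V) (S : Finset E) (v : V) : ℕ :=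
  ∑ e ∈ S, ((if (ends e).1 = v then 1 else 0) + (if (ends e).2 = v then 1 else 0))

/-- The multigraph with edge set `S` is connected: all vertices are mutually reachable. -/
def MConnected (ends : E → V × V) (S : Finset E) : Prop :=
  ∀ u v : V, Relation.ReflTransGen
    (fun a b => ∃ e ∈ S, ends e = (a, b) ∨ ends e = (b, a)) u v

/-- `T` is (the edge set of) a spanning tree: connected and with `|V| - 1` edges. -/
def IsSpanningTree [Fintype V] (ends : E → V × V) (T : Finset E) : Prop :=
  MConnected ends T ∧ T.card + 1 = Fintype.card V

/-- `S` is `m`-tree-connected: it contains `m` pairwise edge-disjoint spanning trees. -/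
def TreeConnected [Fintype V] (ends : E → V × V) (m : ℕ) (S : Finset E) : Prop :=
  ∃ T : Fin m → Finset E, (∀ i, T i ⊆ S ∧ IsSpanningTree ends (T i)) ∧
    ∀ i j, i ≠ j → Disjoint (T i) (T j)

/-- The edges of `S` crossing the cut `(A, Aᶜ)`. -/
def cutEdges [DecidableEq V] (ends : E → V × V) (S : Finset E) (A : Finset V) : Finset E :=
  S.filter fun e => ¬(((ends e).1 ∈ A) ↔ ((ends e).2 ∈ A))

/-- `S` is `m`-edge-connected: every edge cut has at least `m` edges. -/
def EdgeConnected [Fintype V] [DecidableEq V] (ends : E → V × V) (m : ℕ) (S : Finset E) : Prop :=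
  ∀ A : Finset V, A.Nonempty → A ≠ Finset.univ → m ≤ (cutEdges ends S A).card

/-- Tail of the edge `e` under the orientation `σ`. -/
def otail (ends : E → V × V) (σ : E → Bool) (e : E) : V :=
  if σ e then (ends e).1 else (ends e).2

/-- Head of the edge `e` under the orientation `σ`. -/
def ohead (ends : E → V × V) (σ : E → Bool) (e : E) : V :=
  if σ e then (ends e).2 else (ends e).1

/-- Out-degree of `v` in the edge set `S` under the orientation `σ`. -/
def outDeg [DecidableEq V] (ends : E → V × V) (σ : E → Bool) (S : Finset E) (v : V) : ℕ :=
  (S.filter fun e => otail ends σ e = v).card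

/-- In-degree of `v` in the edge set `S` under the orientation `σ`. -/
def inDeg [DecidableEq V] (ends : E → V × V) (σ : E → Bool) (S : Finset E) (v : V) : ℕ :=
  (S.filter fun e => ohead ends σ e = v).card

/-- Out-degree in a directed graph, where `ends` itself records the orientation
(first component = tail, second component = head). -/
def outDegD [DecidableEq V] (ends : E → V × V) (S : Finset E) (v : V) : ℕ :=
  (S.filter fun e => (ends e).1 = v).card

/-- In-degree in a directed graph. -/
def inDegD [DecidableEq V] (ends : E → V × V) (S : Finset E) (v : V) : ℕ :=
  (S.filter fun e => (ends e).2 = v).card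

/-- `S` is `(m, l)`-partition-connected: it decomposes into an `m`-tree-connected factor
and a factor admitting an orientation in which every vertex `v` has out-degree at least `l v`. -/
def PartitionConnected [Fintype V] [DecidableEq V] [DecidableEq E]
    (ends : E → V × V) (m : ℕ) (l : V → ℤ) (S : Finset E) : Prop :=
  ∃ S₁ ⊆ S, TreeConnected ends m S₁ ∧
    ∃ σ : E → Bool, ∀ v, l v ≤ (outDeg ends σ (S \ S₁) v : ℤ)

/-- Number of edges of `S` with both ends in `A`. -/
def eIn [DecidableEq V] (ends : E → V × V) (S : Finset E) (A : Finset V) : ℕ :=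
  (S.filter fun e => (ends e).1 ∈ A ∧ (ends e).2 ∈ A).card

/-- Number of edges of `S` with one end in `A` and the other end in `B`. -/
def eBetween [DecidableEq V] (ends : E → V × V) (S : Finset E) (A B : Finset V) : ℕ :=
  (S.filter fun e =>
    ((ends e).1 ∈ A ∧ (ends e).2 ∈ B) ∨ ((ends e).1 ∈ B ∧ (ends e).2 ∈ A)).card

/-- Every edge of `S` crosses the bipartition `(X, Xᶜ)`. -/
def BipartiteWrt [DecidableEq V] (ends : E → V × V) (S : Finset E) (X : Finset V) : Prop :=
  ∀ e ∈ S, ¬(((ends e).1 ∈ X) ↔ ((ends e).2 ∈ X))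

/-- The multigraph with edge set `S` is bipartite. -/
def IsBipartiteG [DecidableEq V] (ends : E → V × V) (S : Finset E) : Prop :=
  ∃ X : Finset V, BipartiteWrt ends S X

/-- Bipartite index: the smallest number of edges whose deletion from `S`
leaves a bipartite factor. -/
noncomputable def biIndex [DecidableEq V] [DecidableEq E]
    (ends : E → V × V) (S : Finset E) : ℕ :=
  sInf {n | ∃ H ⊆ S, IsBipartiteG ends H ∧ n = (S \ H).card}

/-- `f : V → ZMod k` is compatible with the multigraph `S` with respect to the
bipartition `(X, Xᶜ)`. -/
def CompatibleWrt [Fintype V] [DecidableEq V] (ends : E → V × V) (S : Finset E)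
    {k : ℕ} (f : V → ZMod k) (X : Finset V) : Prop :=
  (∃ x : ℕ, x ≤ eIn ends S X ∧
    (∑ v ∈ X, f v) - 2 * (x : ZMod k) = ∑ v ∈ Xᶜ, f v) ∨
  (∃ y : ℕ, y ≤ eIn ends S Xᶜ ∧
    (∑ v ∈ X, f v) = (∑ v ∈ Xᶜ, f v) - 2 * (y : ZMod k))

/-- `f : V → ZMod k` is compatible with `S`: compatible with respect to every bipartition. -/
def Compatible [Fintype V] [DecidableEq V] (ends : E → V × V) (S : Finset E)
    {k : ℕ} (f : V → ZMod k) : Prop :=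
  ∀ X : Finset V, CompatibleWrt ends S f X

section PartA
set_option linter.unusedSectionVars false
open Matrix

variable {ι ε : Type*} [Fintype ι] [DecidableEq ι] [Fintype ε]

def wLap (b : ε → ι → ℝ) (c : ε → ℝ) (S : Finset ε) : Matrix ι ι ℝ :=
  ∑ e ∈ S, c e • vecMulVec (b e) (b e)

lemma wLap_quad (b : ε → ι → ℝ) (c : ε → ℝ) (S : Finset ε) (v : ι → ℝ) :
    v ⬝ᵥ (wLap b c S *ᵥ v) = ∑ e ∈ S, c e * (b e ⬝ᵥ v) ^ 2 := by
  unfold wLap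
  rw [Matrix.sum_mulVec, dotProduct_sum]
  refine Finset.sum_congr rfl fun e _ => ?_
  rw [Matrix.smul_mulVec, Matrix.vecMulVec_mulVec]
  have h : (MulOpposite.op (b e ⬝ᵥ v)) • b e = (b e ⬝ᵥ v) • b e := by
    ext i; simp [mul_comm]
  rw [h, dotProduct_smul, dotProduct_smul, dotProduct_comm v (b e), smul_eq_mul, smul_eq_mul]
  ring

lemma wLap_herm (b : ε → ι → ℝ) (c : ε → ℝ) (S : Finset ε) : (wLap b c S).IsHermitian := by
  unfold wLap
  rw [Matrix.IsHermitian, Matrix.conjTranspose_sum]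
  refine Finset.sum_congr rfl fun e _ => ?_
  ext i j
  simp [vecMulVec_apply, mul_comm]

lemma wLap_psd (b : ε → ι → ℝ) (c : ε → ℝ) (S : Finset ε) (hc : ∀ e, 0 ≤ c e) :
    (wLap b c S).PosSemidef := by
  refine Matrix.PosSemidef.of_dotProduct_mulVec_nonneg (wLap_herm b c S) fun v => ?_
  rw [star_trivial, wLap_quad]
  exact Finset.sum_nonneg fun e _ => mul_nonneg (hc e) (sq_nonneg _)

lemma wLap_posDef (b : ε → ι → ℝ) (c : ε → ℝ) (hc : ∀ e, 0 < c e)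
    (hb : Submodule.span ℝ (Set.range b) = ⊤) : (wLap b c univ).PosDef := by
  refine Matrix.PosDef.of_dotProduct_mulVec_pos (wLap_herm b c _) fun v hv => ?_
  rw [star_trivial, wLap_quad]
  by_contra hneg
  have h0 : ∀ e ∈ (univ : Finset ε), c e * (b e ⬝ᵥ v) ^ 2 = 0 := by
    rw [← Finset.sum_eq_zero_iff_of_nonneg fun e _ => mul_nonneg (hc e).le (sq_nonneg _)]
    exact le_antisymm (not_lt.mp hneg)
      (Finset.sum_nonneg fun e _ => mul_nonneg (hc e).le (sq_nonneg _))
  have h1 : ∀ w : ι → ℝ, w ⬝ᵥ v = 0 := by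
    intro w
    have hw : w ∈ Submodule.span ℝ (Set.range b) := by rw [hb]; trivial
    induction hw using Submodule.span_induction with
    | mem x hx =>
      obtain ⟨e, rfl⟩ := hx
      have := h0 e (mem_univ _)
      have h2 := (hc e).ne'
      simpa [h2] using this
    | zero => simp
    | add x y _ _ hx hy => simp [add_dotProduct, hx, hy]
    | smul a x _ hx => simp [smul_dotProduct, hx]
  exact hv (dotProduct_self_eq_zero.mp (h1 v))

lemma det_rankOne (A : Matrix ι ι ℝ) (hA : A.PosDef) (s : ℝ) (v : ι → ℝ) :
    (A + s • vecMulVec v v).det = A.det * (1 + s * (v ⬝ᵥ (A⁻¹ *ᵥ v))) := by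
  have hu : IsUnit A.det := isUnit_iff_ne_zero.mpr hA.det_pos.ne'
  have h := Matrix.det_add_replicateCol_mul_replicateRow (ι := Unit) hu (s • v) v
  have e1 : replicateCol Unit (s • v) * replicateRow Unit v = s • vecMulVec v v := by
    ext i j
    simp [Matrix.mul_apply, vecMulVec_apply, mul_assoc]
  rw [e1] at h
  rw [h]
  congr 1
  rw [Matrix.mul_assoc, ← Matrix.replicateCol_mulVec, Matrix.mulVec_smul,
    Matrix.det_unique (n := Unit)]
  simp only [Matrix.add_apply, Matrix.one_apply_eq, Matrix.mul_apply, Matrix.replicateRow_apply,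
    Matrix.replicateCol_apply, dotProduct, Finset.mul_sum, Pi.smul_apply, smul_eq_mul]
  congr 1
  refine Finset.sum_congr rfl fun i _ => by ring

lemma det_add_wLap_le (b : ε → ι → ℝ) (c : ε → ℝ) (hc : ∀ e, 0 ≤ c e) (A : Matrix ι ι ℝ)
    (hA : A.PosDef) (S : Finset ε) : A.det ≤ (A + wLap b c S).det := by
  classical
  induction S using Finset.induction_on with
  | empty => simp [wLap]
  | insert e S he ih =>
    refine ih.trans ?_
    have hp : (A + wLap b c S).PosDef := hA.add_posSemidef (wLap_psd b c S hc)
    have e1 : A + wLap b c (insert e S) = (A + wLap b c S) + c e • vecMulVec (b e) (b e) := by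
      simp only [wLap]
      rw [Finset.sum_insert he]; abel
    rw [e1, det_rankOne _ hp]
    have h2 : 0 ≤ b e ⬝ᵥ ((A + wLap b c S)⁻¹ *ᵥ b e) := by
      simpa using hp.inv.posSemidef.dotProduct_mulVec_nonneg (b e)
    have := mul_nonneg (hp.det_pos.le) (mul_nonneg (hc e) h2)
    linarith

lemma span_top_of_count (b : ε → ι → ℝ) (K : ℕ) (hK : 1 ≤ K)
    (hW : ∀ W : Submodule ℝ (ι → ℝ), K * Fintype.card ι ≤
      K * Module.finrank ℝ W + Nat.card {e : ε // b e ∉ W}) :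
    Submodule.span ℝ (Set.range b) = ⊤ := by
  have h := hW (Submodule.span ℝ (Set.range b))
  have h0 : Nat.card {e : ε // b e ∉ Submodule.span ℝ (Set.range b)} = 0 := by
    have : IsEmpty {e : ε // b e ∉ Submodule.span ℝ (Set.range b)} :=
      ⟨fun x => x.2 (Submodule.subset_span ⟨_, rfl⟩)⟩
    exact Nat.card_of_isEmpty
  rw [h0, add_zero] at h
  apply Submodule.eq_top_of_finrank_eq
  apply le_antisymm (Submodule.finrank_le _)
  rw [Module.finrank_fintype_fun_eq_card]
  exact Nat.le_of_mul_le_mul_left h hK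

lemma exists_basis_rows (b : ε → ι → ℝ) (hb : Submodule.span ℝ (Set.range b) = ⊤) :
    ∃ T : ι → ε, (Matrix.of fun i => b (T i)).det ≠ 0 := by
  obtain ⟨κ, a, ha, hsp, hli⟩ := exists_linearIndependent' ℝ b
  rw [hb] at hsp
  let B := Module.Basis.mk hli hsp.ge
  have hfin : Finite κ := Module.Finite.finite_basis B
  have := Fintype.ofFinite κ
  have hcard : Fintype.card κ = Fintype.card ι := by
    rw [← Module.finrank_eq_card_basis B, Module.finrank_fintype_fun_eq_card]
  obtain ⟨σ⟩ := Fintype.card_eq.mp hcard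
  refine ⟨fun i => a (σ.symm i), ?_⟩
  have hli2 : LinearIndependent ℝ (fun i => b (a (σ.symm i))) :=
    hli.comp _ σ.symm.injective
  have := (Matrix.linearIndependent_rows_iff_isUnit (A := Matrix.of fun i => b (a (σ.symm i)))).mp hli2
  rw [Matrix.isUnit_iff_isUnit_det] at this
  exact this.ne_zero

/-- A basis maximizing the weight dominates all coefficients. -/
lemma exists_max_basis (b : ε → ι → ℝ) (hb : Submodule.span ℝ (Set.range b) = ⊤)
    (c : ε → ℝ) (hc : ∀ e, 0 < c e) :
    ∃ T : ι → ε, (Matrix.of fun i => b (T i)).det ≠ 0 ∧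
      ∀ e, ∃ α : ι → ℝ, b e = ∑ i, α i • b (T i) ∧ ∀ i, α i ≠ 0 → c e ≤ c (T i) := by
  classical
  have hfin : (Finset.univ.filter fun T : ι → ε => (Matrix.of fun i => b (T i)).det ≠ 0).Nonempty := by
    obtain ⟨T, hT⟩ := exists_basis_rows b hb
    exact ⟨T, by simpa using hT⟩
  obtain ⟨T, hT, hmax⟩ := Finset.exists_max_image _ (fun T => ∏ i, c (T i)) hfin
  simp only [mem_filter, mem_univ, true_and] at hT hmax
  refine ⟨T, hT, fun e => ?_⟩
  set A : Matrix ι ι ℝ := Matrix.of fun i => b (T i) with hA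
  have hu : IsUnit A.det := isUnit_iff_ne_zero.mpr hT
  have hα : b e = ∑ i, (b e ᵥ* A⁻¹) i • b (T i) := by
    have h1 : (b e ᵥ* A⁻¹) ᵥ* A = b e := by
      rw [Matrix.vecMul_vecMul, Matrix.nonsing_inv_mul _ hu, Matrix.vecMul_one]
    conv_lhs => rw [← h1]
    ext j
    simp [Matrix.vecMul, dotProduct, hA, Finset.sum_apply]
  refine ⟨b e ᵥ* A⁻¹, hα, fun i hi => ?_⟩
  by_contra hlt
  push Not at hlt
  have hd : (Matrix.of fun j => b (Function.update T i e j)).det ≠ 0 := by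
    have e1 : (Matrix.of fun j => b (Function.update T i e j)) =
        A.updateRow i (∑ j, (b e ᵥ* A⁻¹) j • A j) := by
      ext j l
      by_cases hj : j = i
      · subst hj
        simp only [Matrix.of_apply, Function.update_self, Matrix.updateRow_self]
        conv_lhs => rw [hα]
        rfl
      · simp [Function.update_of_ne hj, Matrix.updateRow_ne hj, hA]
    rw [e1, Matrix.det_updateRow_sum]
    simp only [smul_eq_mul]
    exact mul_ne_zero hi hT
  have := hmax _ hd
  have e2 : ∏ j, c (Function.update T i e j) = c e * ∏ j ∈ univ.erase i, c (T j) := by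
    rw [← Finset.mul_prod_erase univ _ (mem_univ i)]
    congr 1
    · simp
    · refine Finset.prod_congr rfl fun j hj => ?_
      rw [Function.update_of_ne (Finset.ne_of_mem_erase hj)]
  rw [e2, ← Finset.mul_prod_erase univ (fun j => c (T j)) (mem_univ i)] at this
  have hp : 0 < ∏ j ∈ univ.erase i, c (T j) := Finset.prod_pos fun j _ => hc _
  nlinarith [mul_lt_mul_of_pos_right hlt hp]

lemma prod_le_of_count [DecidableEq ε] (b : ε → ι → ℝ) (K : ℕ)
    (hW : ∀ W : Submodule ℝ (ι → ℝ), K * Fintype.card ι ≤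
      K * Module.finrank ℝ W + Nat.card {e : ε // b e ∉ W})
    (c : ε → ℝ) (hc : ∀ e, 0 < c e) (hc1 : ∀ e, c e ≤ 1) (T : ι → ε)
    (hT : ∀ e, ∃ α : ι → ℝ, b e = ∑ i, α i • b (T i) ∧ ∀ i, α i ≠ 0 → c e ≤ c (T i)) :
    ∏ e, c e ≤ (∏ i, c (T i)) ^ K := by
  classical
  have key : ∀ t : ℝ, K * #{i | c (T i) ≤ t} ≤ #{e | c e ≤ t} := by
    intro t
    set W := Submodule.span ℝ ((univ.filter fun i => ¬ c (T i) ≤ t).image (fun i => b (T i)) : Set (ι → ℝ)) with hWd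
    have h := hW W
    have h1 : Module.finrank ℝ W ≤ #{i | ¬ c (T i) ≤ t} :=
      (finrank_span_finset_le_card _).trans Finset.card_image_le
    have h2 : Nat.card {e : ε // b e ∉ W} ≤ #{e | c e ≤ t} := by
      rw [Nat.card_eq_fintype_card, Fintype.card_subtype]
      refine Finset.card_le_card fun e he => ?_
      simp only [mem_filter, mem_univ, true_and] at he ⊢
      by_contra hlt
      apply he
      obtain ⟨α, hα, hα2⟩ := hT e
      rw [hα]
      refine Submodule.sum_mem _ fun i _ => ?_
      by_cases h0 : α i = 0
      · simp [h0]
      · refine Submodule.smul_mem _ _ (Submodule.subset_span ?_)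
        simp only [coe_image, coe_filter, mem_univ, true_and, Set.mem_image, Set.mem_ofPred_eq]
        exact ⟨i, fun h => hlt ((hα2 i h0).trans h), rfl⟩
    have h3 : #{i | c (T i) ≤ t} + #{i | ¬ c (T i) ≤ t} = Fintype.card ι :=
      Finset.card_filter_add_card_filter_not _
    rw [← h3, mul_add] at h
    have := Nat.mul_le_mul_left K h1
    omega
  have hall := (Finset.all_card_le_biUnion_card_iff_exists_injective
    (fun p : ι × Fin K => univ.filter fun e => c e ≤ c (T p.1))).mp (by
      intro A
      rcases A.eq_empty_or_nonempty with rfl | hA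
      · simp
      obtain ⟨p, hp, hmax⟩ := Finset.exists_max_image A (fun p => c (T p.1)) hA
      have h1 : #A ≤ K * #{i | c (T i) ≤ c (T p.1)} := by
        have : A ⊆ ({i | c (T i) ≤ c (T p.1)} : Finset ι) ×ˢ (univ : Finset (Fin K)) := by
          intro q hq
          simp [hmax q hq]
        refine (Finset.card_le_card this).trans ?_
        rw [Finset.card_product, mul_comm]
        simp
      refine (h1.trans (key _)).trans (Finset.card_le_card ?_)
      exact Finset.subset_biUnion_of_mem (fun p : ι × Fin K => univ.filter fun e => c e ≤ c (T p.1)) hp)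
  obtain ⟨g, hg, hg2⟩ := hall
  have h1 : ∏ e, c e ≤ ∏ e ∈ univ.image g, c e := by
    rw [← Finset.prod_sdiff (Finset.subset_univ (univ.image g))]
    have : ∏ e ∈ univ \ univ.image g, c e ≤ 1 :=
      Finset.prod_le_one (fun e _ => (hc e).le) fun e _ => hc1 e
    have hp : 0 ≤ ∏ e ∈ univ.image g, c e := Finset.prod_nonneg fun e _ => (hc e).le
    nlinarith
  refine h1.trans ?_
  rw [Finset.prod_image (fun x _ y _ h => hg h)]
  have h2 : ∏ p, c (g p) ≤ ∏ p : ι × Fin K, c (T p.1) :=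
    Finset.prod_le_prod (fun p _ => (hc _).le) fun p _ => by simpa using hg2 p
  refine h2.trans (le_of_eq ?_)
  rw [Fintype.prod_prod_type]
  simp [Finset.prod_pow]

lemma prod_le_det (b : ε → ι → ℤ) (c : ε → ℝ) (hc : ∀ e, 0 < c e) (T : ι → ε)
    (hT : (Matrix.of fun i => fun j => ((b (T i) j : ℤ) : ℝ)).det ≠ 0) :
    ∏ i, c (T i) ≤ (wLap (fun e i => (b e i : ℝ)) c univ).det := by
  classical
  set br : ε → ι → ℝ := fun e i => (b e i : ℝ) with hbr
  set A : Matrix ι ι ℝ := Matrix.of fun i => fun j => ((b (T i) j : ℤ) : ℝ) with hA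
  have hinj : Function.Injective T := by
    intro i j hij
    by_contra hne
    exact hT (Matrix.det_zero_of_row_eq hne (by ext l; simp [hA, hij]))
  have h1 : wLap br c (univ.image T) = Aᵀ * (Matrix.diagonal fun i => c (T i)) * A := by
    unfold wLap
    rw [Finset.sum_image fun x _ y _ h => hinj h]
    ext i j
    simp only [Matrix.sum_apply, Matrix.smul_apply, vecMulVec_apply, smul_eq_mul]
    rw [Matrix.mul_apply]
    refine Finset.sum_congr rfl fun l _ => ?_
    simp [Matrix.mul_diagonal, hA, hbr]
    ring
  have hdet : (wLap br c (univ.image T)).det = A.det ^ 2 * ∏ i, c (T i) := by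
    rw [h1, Matrix.det_mul, Matrix.det_mul, Matrix.det_transpose, Matrix.det_diagonal]; ring
  have hpd : (wLap br c (univ.image T)).PosDef := by
    have hps := wLap_psd br c (univ.image T) fun e => (hc e).le
    refine hps.posDef_iff_isUnit.mpr ?_
    rw [Matrix.isUnit_iff_isUnit_det, isUnit_iff_ne_zero, hdet]
    exact mul_ne_zero (pow_ne_zero _ hT) (Finset.prod_pos fun i _ => hc _).ne'
  have h2 := det_add_wLap_le br c (fun e => (hc e).le) _ hpd (univ \ univ.image T)
  have h3 : wLap br c (univ.image T) + wLap br c (univ \ univ.image T) = wLap br c univ := by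
    unfold wLap
    rw [add_comm, Finset.sum_sdiff (Finset.subset_univ _)]
  rw [h3, hdet] at h2
  refine le_trans ?_ h2
  have hz : A.det = (((Matrix.of fun i => fun j => b (T i) j).det : ℤ) : ℝ) := by
    exact ((Int.castRingHom ℝ).map_det (Matrix.of fun i => fun j => b (T i) j)).symm
  have h4 : (1 : ℝ) ≤ A.det ^ 2 := by
    rw [hz] at hT ⊢
    have h5 : (Matrix.of fun i => fun j => b (T i) j).det ≠ 0 := by
      intro h; apply hT; rw [h]; simp
    have : (1 : ℤ) ≤ (Matrix.of fun i => fun j => b (T i) j).det ^ 2 := by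
      have := sq_pos_of_ne_zero h5
      omega
    exact_mod_cast this
  have h6 : 0 < ∏ i, c (T i) := Finset.prod_pos fun i _ => hc _
  nlinarith

theorem exists_weights (b : ε → ι → ℤ) (K : ℕ) (hK : 1 ≤ K)
    (hW : ∀ W : Submodule ℝ (ι → ℝ), K * Fintype.card ι ≤
      K * Module.finrank ℝ W + Nat.card {e : ε // (fun i => (b e i : ℝ)) ∉ W})
    (η : ℝ) (hη : 0 < η) :
    ∃ c : ε → ℝ, (∀ e, 0 < c e) ∧ (∀ e, c e ≤ 1) ∧
      (wLap (fun e i => (b e i : ℝ)) c univ).PosDef ∧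
      ∀ e, c e * ((fun i => (b e i : ℝ)) ⬝ᵥ
        ((wLap (fun e i => (b e i : ℝ)) c univ)⁻¹ *ᵥ (fun i => (b e i : ℝ)))) ≤ 1 / K + η := by
  classical
  set br : ε → ι → ℝ := fun e i => (b e i : ℝ) with hbr
  have hsp := span_top_of_count br K hK hW
  have hge : ∀ c : ε → ℝ, (∀ e, 0 < c e) → (∀ e, c e ≤ 1) →
      1 ≤ (wLap br c univ).det ^ K / ∏ e, c e := by
    intro c hc hc1
    obtain ⟨T, hT, hT2⟩ := exists_max_basis br hsp c hc
    have h1 := prod_le_of_count br K hW c hc hc1 T hT2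
    have h2 := prod_le_det b c hc T hT
    rw [one_le_div (Finset.prod_pos fun e _ => hc e)]
    exact h1.trans (pow_le_pow_left₀ (Finset.prod_nonneg fun i _ => (hc _).le) h2 K)
  have hKr : (1 : ℝ) ≤ K := by exact_mod_cast hK
  have hKη : 0 < (K : ℝ) * η := by positivity
  obtain ⟨s, hs0, hs1, hs2⟩ : ∃ s : ℝ, 0 < s ∧ s ≤ 1 / 2 ∧ s ≤ K * η / 4 :=
    ⟨min (1 / 2) (K * η / 4), lt_min (by norm_num) (by positivity), min_le_left _ _, min_le_right _ _⟩
  set δ : ℝ := s * (K * η) / 8 with hδ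
  have hδ0 : 0 < δ := by positivity
  set P : Set ℝ := {x | ∃ c : ε → ℝ, (∀ e, 0 < c e) ∧ (∀ e, c e ≤ 1) ∧
    x = (wLap br c univ).det ^ K / ∏ e, c e} with hP
  have hPne : P.Nonempty := ⟨_, fun _ => 1, fun _ => one_pos, fun _ => le_rfl, rfl⟩
  have hPb : BddBelow P := ⟨1, by rintro x ⟨c, h1, h2, rfl⟩; exact hge c h1 h2⟩
  have hinf1 : 1 ≤ sInf P := le_csInf hPne (by rintro x ⟨c, h1, h2, rfl⟩; exact hge c h1 h2)
  obtain ⟨x, ⟨c, hc, hc1, rfl⟩, hx⟩ := exists_lt_of_csInf_lt hPne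
    (show sInf P < (1 + δ) * sInf P by nlinarith)
  have hpd := wLap_posDef br c hc hsp
  refine ⟨c, hc, hc1, hpd, fun e => ?_⟩
  set c' : ε → ℝ := Function.update c e (c e * (1 - s)) with hc'
  have hc'0 : ∀ a, 0 < c' a := by
    intro a
    by_cases h : a = e
    · subst h; simp only [hc', Function.update_self]; exact mul_pos (hc _) (by linarith)
    · simp only [hc', Function.update_of_ne h]; exact hc a
  have hc'1 : ∀ a, c' a ≤ 1 := by
    intro a
    by_cases h : a = e
    · subst h; simp only [hc', Function.update_self]; nlinarith [hc a, hc1 a]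
    · simp only [hc', Function.update_of_ne h]; exact hc1 a
  have hcmp : (wLap br c univ).det ^ K / ∏ e, c e < (1 + δ) * ((wLap br c' univ).det ^ K / ∏ e, c' e) :=
    hx.trans_le (mul_le_mul_of_nonneg_left (csInf_le hPb ⟨c', hc'0, hc'1, rfl⟩) (by linarith))
  have hprod : ∏ a, c' a = (1 - s) * ∏ a, c a := by
    rw [← Finset.mul_prod_erase univ c (mem_univ e), ← Finset.mul_prod_erase univ c' (mem_univ e)]
    have : ∏ a ∈ univ.erase e, c' a = ∏ a ∈ univ.erase e, c a :=
      Finset.prod_congr rfl fun j hj => by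
        simp [hc', Function.update_of_ne (Finset.ne_of_mem_erase hj)]
    rw [this]; simp [hc']; ring
  have hL : wLap br c' univ = wLap br c univ + (-(s * c e)) • vecMulVec (br e) (br e) := by
    unfold wLap
    rw [← Finset.add_sum_erase univ _ (mem_univ e), ← Finset.add_sum_erase univ (fun e => c e • vecMulVec (br e) (br e)) (mem_univ e)]
    have : ∑ a ∈ univ.erase e, c' a • vecMulVec (br a) (br a) = ∑ a ∈ univ.erase e, c a • vecMulVec (br a) (br a) :=
      Finset.sum_congr rfl fun j hj => by
        simp [hc', Function.update_of_ne (Finset.ne_of_mem_erase hj)]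
    rw [this]; simp only [hc', Function.update_self]
    module
  have hdet := det_rankOne _ hpd (-(s * c e)) (br e)
  rw [← hL] at hdet
  have hpd' := (wLap_posDef br c' hc'0 hsp).det_pos
  set ℓ : ℝ := c e * (br e ⬝ᵥ ((wLap br c univ)⁻¹ *ᵥ br e)) with hℓ
  have e3 : 1 + -(s * c e) * (br e ⬝ᵥ ((wLap br c univ)⁻¹ *ᵥ br e)) = 1 - s * ℓ := by
    rw [hℓ]; ring
  rw [e3] at hdet
  have hD := hpd.det_pos
  have hpos : 0 < 1 - s * ℓ := by
    rw [hdet] at hpd'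
    exact pos_of_mul_pos_right hpd' hD.le
  have hQ : 0 < ∏ a, c a := Finset.prod_pos fun a _ => hc a
  have hmain : 1 - s < (1 + δ) * (1 - s * ℓ) ^ K := by
    rw [hdet, hprod, mul_pow] at hcmp
    rw [← mul_div_assoc, div_lt_div_iff₀ hQ (mul_pos (by linarith) hQ)] at hcmp
    have hDK : 0 < (wLap br c univ).det ^ K := pow_pos hD K
    have : (wLap br c univ).det ^ K * (∏ a, c a) * (1 - s) <
        (wLap br c univ).det ^ K * (∏ a, c a) * ((1 + δ) * (1 - s * ℓ) ^ K) := by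
      nlinarith
    exact lt_of_mul_lt_mul_left this (by positivity)
  by_contra hcon
  push Not at hcon
  set a : ℝ := s * (1 / K + η) with ha
  have ha0 : 0 < a := by positivity
  have haℓ : 1 - s * ℓ ≤ 1 - a := by nlinarith
  have h1a : 0 < 1 - a := by linarith
  have hb1 : (1 - s * ℓ) ^ K ≤ (1 - a) ^ K := pow_le_pow_left₀ hpos.le haℓ K
  have hb2 : 1 + K * a ≤ (1 + a) ^ K := one_add_mul_le_pow (by linarith) K
  have hb3 : (1 - a) ^ K * (1 + a) ^ K ≤ 1 := by
    rw [← mul_pow]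
    exact pow_le_one₀ (by nlinarith) (by nlinarith)
  have hb4 : (1 - a) ^ K * (1 + K * a) ≤ 1 :=
    (mul_le_mul_of_nonneg_left hb2 (pow_pos h1a K).le).trans hb3
  have hKa : K * a = s + s * (K * η) := by
    rw [ha]; field_simp
  have hb5 : (1 - s) * (1 + K * a) ≤ 1 + δ := by
    have h0 : 0 ≤ 1 + K * a := by positivity
    calc (1 - s) * (1 + K * a) ≤ ((1 + δ) * (1 - a) ^ K) * (1 + K * a) :=
          mul_le_mul_of_nonneg_right (hmain.le.trans (mul_le_mul_of_nonneg_left hb1 (by linarith))) h0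
      _ = (1 + δ) * ((1 - a) ^ K * (1 + K * a)) := by ring
      _ ≤ (1 + δ) * 1 := mul_le_mul_of_nonneg_left hb4 (by linarith)
      _ = 1 + δ := by ring
  rw [hKa, hδ] at hb5
  have hx1 : s * s ≤ s * (K * η / 4) := mul_le_mul_of_nonneg_left hs2 hs0.le
  have hx2 : s * (s * (K * η)) ≤ 1 / 2 * (s * (K * η)) :=
    mul_le_mul_of_nonneg_right hs1 (by positivity)
  have hx3 : 0 < s * (K * η) := by positivity
  nlinarith

end PartA

section PartB
open Matrix
set_option linter.unusedSectionVars false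

variable {ι ε : Type*} [Fintype ι] [DecidableEq ι] [Fintype ε]

lemma quad_shift (M : Matrix ι ι ℝ) (hM : Mᵀ = M) (u v : ι → ℝ) (a : ℝ) :
    (u + a • v) ⬝ᵥ (M *ᵥ (u + a • v)) =
      u ⬝ᵥ (M *ᵥ u) + 2 * a * (v ⬝ᵥ (M *ᵥ u)) + a ^ 2 * (v ⬝ᵥ (M *ᵥ v)) := by
  have h : u ⬝ᵥ (M *ᵥ v) = v ⬝ᵥ (M *ᵥ u) := by
    rw [Matrix.dotProduct_mulVec, ← Matrix.mulVec_transpose, hM, dotProduct_comm]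
  rw [Matrix.mulVec_add, Matrix.mulVec_smul]
  simp only [add_dotProduct, dotProduct_add, smul_dotProduct, dotProduct_smul, smul_eq_mul, h]
  ring

theorem exists_frac (b : ε → ι → ℤ) (K : ℕ) (hK : 1 ≤ K)
    (hW : ∀ W : Submodule ℝ (ι → ℝ), K * Fintype.card ι ≤
      K * Module.finrank ℝ W + Nat.card {e : ε // (fun i => (b e i : ℝ)) ∉ W})
    (η : ℝ) (hη : 0 < η) (r : ι → ℤ) (μ : ℝ) (k : ℕ) (hk : 1 ≤ k) :
    ∃ x : ε → ℝ, (∀ e, |x e - μ| ≤ k / 2 * (1 / K + η)) ∧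
      ∃ s : ι → ℤ, (∀ i, (k : ℤ) ∣ s i - r i) ∧ ∀ i, ∑ e, x e * b e i = s i := by
  obtain ⟨c, hc, hc1, hpd, hl⟩ := exists_weights b K hK hW (η / 2) (by positivity)
  set br : ε → ι → ℝ := fun e i => (b e i : ℝ) with hbr
  set L := wLap br c univ with hL
  have hkr : (1 : ℝ) ≤ k := by exact_mod_cast hk
  have hM : (L⁻¹)ᵀ = L⁻¹ := by
    have := hpd.inv.isHermitian
    rwa [Matrix.IsHermitian, Matrix.conjTranspose_eq_transpose_of_trivial] at this
  set s0 : ι → ℝ := fun i => ∑ e, μ * br e i with hs0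
  set sv : (ι → ℤ) → ι → ℝ := fun t i => ((r i + k * t i : ℤ) : ℝ) - s0 i with hsv
  set q : (ι → ℤ) → ℝ := fun t => sv t ⬝ᵥ (L⁻¹ *ᵥ sv t) with hq
  have hb : BddBelow (Set.range q) := ⟨0, by
    rintro _ ⟨t, rfl⟩
    simpa using hpd.inv.posSemidef.dotProduct_mulVec_nonneg (sv t)⟩
  set δ : ℝ := k ^ 2 * η / 2 with hδ
  have hδ0 : 0 < δ := by positivity
  obtain ⟨_, ⟨t, rfl⟩, ht⟩ := exists_lt_of_csInf_lt (Set.range_nonempty q)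
    (show sInf (Set.range q) < sInf (Set.range q) + δ by linarith)
  have hmin : ∀ t', q t < q t' + δ := fun t' =>
    ht.trans_le (by linarith [csInf_le hb ⟨t', rfl⟩])
  have hmove : ∀ e (σ : ℤ), sv (fun i => t i + σ * b e i) = sv t + ((k : ℝ) * σ) • br e := by
    intro e σ
    ext i
    simp only [hsv, hbr, Pi.add_apply, Pi.smul_apply, smul_eq_mul]
    push_cast; ring
  refine ⟨fun e => μ + c e * (br e ⬝ᵥ (L⁻¹ *ᵥ sv t)), fun e => ?_, fun i => r i + k * t i,
    fun i => ⟨t i, by ring⟩, fun i => ?_⟩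
  · have h1 := hmin (fun i => t i + 1 * b e i)
    have h2 := hmin (fun i => t i + (-1) * b e i)
    simp only [hq] at h1 h2
    rw [hmove e 1, quad_shift _ hM] at h1
    rw [hmove e (-1), quad_shift _ hM] at h2
    push_cast at h1 h2
    set p := br e ⬝ᵥ (L⁻¹ *ᵥ sv t) with hp
    set l := br e ⬝ᵥ (L⁻¹ *ᵥ br e) with hl2
    have hle := hl e
    have hce := hc e
    have hce1 := hc1 e
    have g1 : -(2 * p) ≤ k * l + k * η / 2 := by
      have : k * (-(2 * p)) ≤ k * (k * l + k * η / 2) := by rw [hδ] at h1; nlinarith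
      exact le_of_mul_le_mul_left this (by linarith)
    have g2 : 2 * p ≤ k * l + k * η / 2 := by
      have : k * (2 * p) ≤ k * (k * l + k * η / 2) := by rw [hδ] at h2; nlinarith
      exact le_of_mul_le_mul_left this (by linarith)
    have g3 : c e * (k * η / 2) ≤ k * η / 2 := by
      have : 0 ≤ k * η / 2 := by positivity
      nlinarith
    have g4 : k * (c e * l) ≤ k * (1 / K + η / 2) := mul_le_mul_of_nonneg_left hle (by linarith)
    have g5 := mul_le_mul_of_nonneg_left g1 hce.le
    have g6 := mul_le_mul_of_nonneg_left g2 hce.le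
    rw [add_sub_cancel_left, abs_le]
    constructor <;> nlinarith
  · have hu : IsUnit L.det := isUnit_iff_ne_zero.mpr hpd.det_pos.ne'
    have h1 : L *ᵥ (L⁻¹ *ᵥ sv t) = sv t := by
      rw [Matrix.mulVec_mulVec, Matrix.mul_nonsing_inv _ hu, Matrix.one_mulVec]
    have h2 : (L *ᵥ (L⁻¹ *ᵥ sv t)) i = ∑ e, c e * (br e ⬝ᵥ (L⁻¹ *ᵥ sv t)) * br e i := by
      conv_lhs => rw [hL, wLap, Matrix.sum_mulVec, Finset.sum_apply]
      refine Finset.sum_congr rfl fun e _ => ?_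
      rw [Matrix.smul_mulVec, Matrix.vecMulVec_mulVec]
      simp [hL, wLap]
      ring
    rw [h1] at h2
    have h3 : ∑ e, (μ + c e * (br e ⬝ᵥ (L⁻¹ *ᵥ sv t))) * br e i = s0 i + sv t i := by
      rw [h2, hs0, ← Finset.sum_add_distrib]
      refine Finset.sum_congr rfl fun e _ => by ring
    refine h3.trans ?_
    simp [hsv]

end PartB

section PartC
set_option linter.unusedSectionVars false

variable {β V : Type*} [Fintype β] [Fintype V] [DecidableEq V]

/-- incidence number -/
def incN (p q : β → V) (e : β) (v : V) : ℕ := (if p e = v then 1 else 0) + (if q e = v then 1 else 0)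

def sgnX (X : Finset V) (v : V) : ℤ := if v ∈ X then 1 else -1

lemma sgnX_sq (X : Finset V) (v : V) : sgnX X v * sgnX X v = 1 := by
  unfold sgnX; split_ifs <;> rfl

lemma sgnX_inc (p q : β → V) (X : Finset V) (hp : ∀ e, p e ∈ X) (hq : ∀ e, q e ∉ X) (e : β) (v : V) :
    ((if p e = v then 1 else 0) - (if q e = v then 1 else 0) : ℤ) = sgnX X v * incN p q e v := by
  have h1 := hp e
  have h2 := hq e
  unfold sgnX incN
  split_ifs <;> simp_all

lemma sum_sgnX_inc (p q : β → V) (X : Finset V) (hp : ∀ e, p e ∈ X) (hq : ∀ e, q e ∉ X) (e : β) :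
    ∑ v, sgnX X v * (incN p q e v : ℤ) = 0 := by
  simp_rw [← sgnX_inc p q X hp hq]
  simp

lemma sum_sgnX_deg (p q : β → V) (X : Finset V) (hp : ∀ e, p e ∈ X) (hq : ∀ e, q e ∉ X) (x : β → ℝ) :
    ∑ v, (sgnX X v : ℝ) * ∑ e, x e * incN p q e v = 0 := by
  simp_rw [Finset.mul_sum]
  rw [Finset.sum_comm]
  refine Finset.sum_eq_zero fun e _ => ?_
  have h := sum_sgnX_inc p q X hp hq e
  have h' : ∑ v, (sgnX X v : ℝ) * (incN p q e v : ℝ) = 0 := by exact_mod_cast h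
  calc ∑ v, (sgnX X v : ℝ) * (x e * incN p q e v) = x e * ∑ v, (sgnX X v : ℝ) * (incN p q e v : ℝ) := by
        rw [Finset.mul_sum]; exact Finset.sum_congr rfl fun v _ => by ring
    _ = 0 := by rw [h', mul_zero]

lemma incN_le_one (p q : β → V) (X : Finset V) (hp : ∀ e, p e ∈ X) (hq : ∀ e, q e ∉ X) (e : β) (v : V) :
    incN p q e v ≤ 1 := by
  have h1 := hp e
  have h2 := hq e
  unfold incN
  split_ifs <;> simp_all

lemma sum_incN (p q : β → V) (e : β) : ∑ v, incN p q e v = 2 := by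
  unfold incN
  rw [Finset.sum_add_distrib]; simp

theorem round_deg (p q : β → V) (X : Finset V) (hp : ∀ e, p e ∈ X) (hq : ∀ e, q e ∉ X)
    (x₀ : β → ℝ) (h0 : ∀ e, 0 ≤ x₀ e) (h1 : ∀ e, x₀ e ≤ 1) (n : V → ℤ)
    (hn : ∀ v, ∑ e, x₀ e * incN p q e v = n v) :
    ∃ S : Finset β, ∀ v, ((∑ e ∈ S, incN p q e v : ℕ) : ℤ) = n v := by
  classical
  set P : Set (β → ℝ) := Set.Icc 0 1 ∩ ⋂ v, {x | ∑ e, x e * incN p q e v = n v} with hP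
  have hPc : IsCompact P := by
    refine IsCompact.inter_right isCompact_Icc (isClosed_iInter fun v => ?_)
    exact isClosed_eq (by fun_prop) continuous_const
  have hPm : ∀ x, x ∈ P ↔ (∀ e, 0 ≤ x e) ∧ (∀ e, x e ≤ 1) ∧ ∀ v, ∑ e, x e * incN p q e v = n v := by
    intro x
    simp only [hP, Set.mem_inter_iff, Set.mem_Icc, Pi.le_def, Set.mem_iInter, Set.mem_ofPred_eq,
      Pi.zero_apply, Pi.one_apply, and_assoc]
  obtain ⟨x, hx⟩ := hPc.extremePoints_nonempty ⟨x₀, (hPm _).2 ⟨h0, h1, hn⟩⟩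
  obtain ⟨hx0, hx1, hxn⟩ := (hPm x).1 hx.1
  set F : Finset β := univ.filter fun e => x e ≠ 0 ∧ x e ≠ 1 with hF
  have hFm : ∀ e, e ∈ F ↔ x e ≠ 0 ∧ x e ≠ 1 := by simp [hF]
  have hout : ∀ e, e ∉ F → x e = (if x e = 1 then 1 else 0 : ℤ) := by
    intro e he
    rw [hFm] at he
    split_ifs with h
    · simp [h]
    · push_cast; tauto
  rcases F.eq_empty_or_nonempty with hFe | ⟨e₀, he₀⟩
  · refine ⟨univ.filter fun e => x e = 1, fun v => ?_⟩
    have h2 : ((∑ e with x e = 1, incN p q e v : ℕ) : ℝ) = n v := by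
      rw [← hxn v, Finset.sum_filter]
      push_cast
      refine Finset.sum_congr rfl fun e _ => ?_
      have h3 := hout e (by simp [hFe])
      split_ifs with h
      · simp [h]
      · simp only [h, if_false] at h3
        rw [h3]; simp
    exact_mod_cast h2
  exfalso
  set VF : Finset V := univ.filter fun v => ∃ e ∈ F, incN p q e v ≠ 0 with hVF
  have htwo : ∀ v ∈ VF, 2 ≤ ∑ e ∈ F, incN p q e v := by
    intro v hv
    simp only [hVF, mem_filter, mem_univ, true_and] at hv
    obtain ⟨e, he, hev⟩ := hv
    by_contra hlt
    have hi1 := incN_le_one p q X hp hq e v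
    have hsum := Finset.add_sum_erase F (fun e => incN p q e v) he
    have hz : ∑ a ∈ F.erase e, incN p q a v = 0 := by omega
    have hz2 := Finset.sum_eq_zero_iff.mp hz
    have hie : incN p q e v = 1 := by omega
    have h2 := hxn v
    rw [← Finset.add_sum_erase univ _ (mem_univ e), hie] at h2
    have h3 : ∑ a ∈ univ.erase e, x a * incN p q a v =
        ((∑ a ∈ univ.erase e, (if x a = 1 then 1 else 0 : ℤ) * incN p q a v : ℤ) : ℝ) := by
      push_cast
      refine Finset.sum_congr rfl fun a ha => ?_
      by_cases haF : a ∈ F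
      · have := hz2 a (Finset.mem_erase.mpr ⟨Finset.ne_of_mem_erase ha, haF⟩)
        simp [this]
      · conv_lhs => rw [hout a haF]
        push_cast; rfl
    rw [h3] at h2
    set N : ℤ := ∑ a ∈ univ.erase e, (if x a = 1 then 1 else 0 : ℤ) * incN p q a v
    have h4 : x e = ((n v - N : ℤ) : ℝ) := by push_cast; push_cast at h2; linarith
    have hne := (hFm e).1 he
    have h5 := hx0 e
    have h6 := hx1 e
    rw [h4] at h5 h6 hne
    have h7 : 0 ≤ n v - N := by exact_mod_cast h5
    have h8 : n v - N ≤ 1 := by exact_mod_cast h6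
    have : n v - N = 0 ∨ n v - N = 1 := by omega
    rcases this with h | h <;> rw [h] at hne <;> simp at hne
  have hcard : #VF ≤ #F := by
    have a1 : 2 * #VF ≤ ∑ v ∈ VF, ∑ e ∈ F, incN p q e v := by
      rw [mul_comm, ← smul_eq_mul]
      exact Finset.card_nsmul_le_sum _ _ _ htwo
    have a2 : ∑ v ∈ VF, ∑ e ∈ F, incN p q e v ≤ ∑ v, ∑ e ∈ F, incN p q e v :=
      Finset.sum_le_sum_of_subset (Finset.subset_univ _)
    have a3 : ∑ v, ∑ e ∈ F, incN p q e v = 2 * #F := by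
      rw [Finset.sum_comm]
      simp [sum_incN, mul_comm]
    omega
  have hv0 : p e₀ ∈ VF := by
    simp only [hVF, mem_filter, mem_univ, true_and]
    exact ⟨e₀, he₀, by simp [incN]⟩
  set v₀ := p e₀
  let φ : (F → ℝ) →ₗ[ℝ] (VF.erase v₀ → ℝ) :=
    { toFun := fun y v => ∑ e : F, y e * incN p q e.1 v.1
      map_add' := by intro y y'; ext v; simp [add_mul, Finset.sum_add_distrib]
      map_smul' := by intro a y; ext v; simp [Finset.mul_sum, mul_assoc] }
  have hker : LinearMap.ker φ ≠ ⊥ := by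
    apply LinearMap.ker_ne_bot_of_finrank_lt
    rw [Module.finrank_fintype_fun_eq_card, Module.finrank_fintype_fun_eq_card, Fintype.card_coe,
      Fintype.card_coe, Finset.card_erase_of_mem hv0]
    have : 0 < #VF := Finset.card_pos.mpr ⟨_, hv0⟩
    omega
  obtain ⟨y, hy, hy0⟩ := (Submodule.ne_bot_iff _).mp hker
  set Y : β → ℝ := fun e => if h : e ∈ F then y ⟨e, h⟩ else 0 with hY
  have hYF : ∀ e, e ∉ F → Y e = 0 := fun e he => by simp [hY, he]
  have hsumY : ∀ v, ∑ e, Y e * incN p q e v = ∑ e : F, y e * incN p q e.1 v := by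
    intro v
    rw [← Finset.sum_subset (Finset.subset_univ F) (fun e _ he => by simp [hYF e he]),
      ← Finset.sum_coe_sort]
    refine Finset.sum_congr rfl fun e _ => ?_
    simp [hY]
  have hd1 : ∀ v, v ≠ v₀ → ∑ e, Y e * incN p q e v = 0 := by
    intro v hv
    rw [hsumY]
    by_cases hvF : v ∈ VF
    · have := congrFun (LinearMap.mem_ker.mp hy) ⟨v, Finset.mem_erase.mpr ⟨hv, hvF⟩⟩
      exact this
    · refine Finset.sum_eq_zero fun e _ => ?_
      have : incN p q e.1 v = 0 := by
        by_contra h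
        exact hvF (by simp only [hVF, mem_filter, mem_univ, true_and]; exact ⟨e.1, e.2, h⟩)
      simp [this]
  have hd : ∀ v, ∑ e, Y e * incN p q e v = 0 := by
    intro v
    by_cases hv : v = v₀
    · have h := sum_sgnX_deg p q X hp hq Y
      rw [Finset.sum_eq_single v₀ (fun v _ hv => by rw [hd1 v hv, mul_zero]) (by simp)] at h
      rw [hv]
      rcases mul_eq_zero.mp h with h | h
      · exfalso
        have hh : sgnX X v₀ = 0 := by exact_mod_cast h
        have := sgnX_sq X v₀
        rw [hh] at this; simp at this
      · exact h
    · exact hd1 v hv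
  have hev : ∀ᶠ δ in nhdsWithin (0 : ℝ) (Set.Ioi 0), ∀ e, 0 ≤ x e + δ * Y e ∧ x e + δ * Y e ≤ 1 ∧
      0 ≤ x e - δ * Y e ∧ x e - δ * Y e ≤ 1 := by
    rw [Filter.eventually_all]
    intro e
    by_cases he : e ∈ F
    · obtain ⟨g0, g1⟩ := (hFm e).1 he
      have g0' : 0 < x e := lt_of_le_of_ne (hx0 e) (Ne.symm g0)
      have g1' : x e < 1 := lt_of_le_of_ne (hx1 e) g1
      have t1 : Filter.Tendsto (fun δ : ℝ => x e + δ * Y e) (nhdsWithin 0 (Set.Ioi 0)) (nhds (x e)) := by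
        have : Continuous fun δ : ℝ => x e + δ * Y e := by fun_prop
        simpa using (this.tendsto 0).mono_left nhdsWithin_le_nhds
      have t2 : Filter.Tendsto (fun δ : ℝ => x e - δ * Y e) (nhdsWithin 0 (Set.Ioi 0)) (nhds (x e)) := by
        have : Continuous fun δ : ℝ => x e - δ * Y e := by fun_prop
        simpa using (this.tendsto 0).mono_left nhdsWithin_le_nhds
      filter_upwards [t1.eventually_const_lt g0', t1.eventually_lt_const g1',
        t2.eventually_const_lt g0', t2.eventually_lt_const g1'] with δ a1 a2 a3 a4
      exact ⟨a1.le, a2.le, a3.le, a4.le⟩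
    · refine Filter.Eventually.of_forall fun δ => ?_
      rw [hYF e he]
      simp [hx0 e, hx1 e]
  obtain ⟨δ, hδ, hδ0⟩ := (hev.and self_mem_nhdsWithin).exists
  have hδ0 : 0 < δ := hδ0
  have m1 : x + δ • Y ∈ P := by
    refine (hPm _).2 ⟨fun e => (hδ e).1, fun e => (hδ e).2.1, fun v => ?_⟩
    simp only [Pi.add_apply, Pi.smul_apply, smul_eq_mul, add_mul, Finset.sum_add_distrib, hxn v, mul_assoc]
    rw [← Finset.mul_sum, hd v]; simp
  have m2 : x - δ • Y ∈ P := by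
    refine (hPm _).2 ⟨fun e => (hδ e).2.2.1, fun e => (hδ e).2.2.2, fun v => ?_⟩
    simp only [Pi.sub_apply, Pi.smul_apply, smul_eq_mul, sub_mul, Finset.sum_sub_distrib, hxn v, mul_assoc]
    rw [← Finset.mul_sum, hd v]; simp
  have hseg : x ∈ openSegment ℝ (x + δ • Y) (x - δ • Y) := by
    refine ⟨1 / 2, 1 / 2, by norm_num, by norm_num, by norm_num, ?_⟩
    module
  have heq := hx.2 m1 m2 hseg
  apply hy0
  ext e
  have h9 := congrFun heq e.1
  simp only [Pi.add_apply, Pi.smul_apply, smul_eq_mul] at h9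
  have h10 : δ * Y e.1 = 0 := by linarith
  have h11 : Y e.1 = 0 := by
    rcases mul_eq_zero.mp h10 with h | h
    · exact absurd h hδ0.ne'
    · exact h
  simpa [hY] using h11


theorem frac_deg (p q : β → V) (X : Finset V) (hp : ∀ e, p e ∈ X) (hq : ∀ e, q e ∉ X)
    (k : ℕ) (hk : 2 ≤ k) (z : V)
    (hW : ∀ W : Submodule ℝ ({v : V // v ≠ z} → ℝ), (2 * k - 2) * Fintype.card {v : V // v ≠ z} ≤
      (2 * k - 2) * Module.finrank ℝ W + Nat.card {e : β //
        (fun i : {v : V // v ≠ z} => (((if p e = i.1 then 1 else 0) - (if q e = i.1 then 1 else 0) : ℤ) : ℝ)) ∉ W})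
    (g : V → ZMod k) (hg : ∑ v, (sgnX X v : ZMod k) * g v = 0)
    (η : ℝ) (hη : 0 < η) :
    ∃ x : β → ℝ, (∀ e, -η ≤ x e) ∧ (∀ e, x e ≤ 1) ∧ ∀ v, ∃ n : ℤ, (n : ZMod k) = g v ∧
      (v ≠ z → n ≤ ∑ e, (incN p q e v : ℤ) - (k - 1)) ∧ ∑ e, x e * incN p q e v = n := by
  classical
  have hkr : (2 : ℝ) ≤ k := by exact_mod_cast hk
  have hKr : ((2 * k - 2 : ℕ) : ℝ) = 2 * k - 2 := by
    rw [Nat.cast_sub (by omega)]; push_cast; ring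
  set ξ : ℝ := η / (2 * k) with hξ
  have hξ0 : 0 < ξ := by positivity
  have hkξ : k * ξ = η / 2 := by rw [hξ]; field_simp
  have : NeZero k := ⟨by omega⟩
  obtain ⟨x, hx, s, hs, hxs⟩ := exists_frac
    (fun (e : β) (i : {v : V // v ≠ z}) => ((if p e = i.1 then 1 else 0) - (if q e = i.1 then 1 else 0) : ℤ))
    (2 * k - 2) (by omega) hW ξ hξ0 (fun i => sgnX X i.1 * ((g i.1).val : ℤ))
    (k / (4 * k - 4) - k * ξ) k (by omega)
  have hlo : ∀ e, -(3 / 2 * (k * ξ)) ≤ x e ∧ x e ≤ k / (2 * k - 2) - k * ξ / 2 := by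
    intro e
    have h := abs_le.mp (hx e)
    rw [hKr] at h
    have e1 : (k : ℝ) / 2 * (1 / (2 * k - 2) + ξ) = k / (4 * k - 4) + k * ξ / 2 := by
      have : (2 * k - 2 : ℝ) ≠ 0 := by linarith
      have : (4 * k - 4 : ℝ) ≠ 0 := by linarith
      have : (k - 1 : ℝ) ≠ 0 := by linarith
      field_simp
      ring
    have e2 : (k : ℝ) / (2 * k - 2) = 2 * (k / (4 * k - 4)) := by
      have : (2 * k - 2 : ℝ) ≠ 0 := by linarith
      have : (4 * k - 4 : ℝ) ≠ 0 := by linarith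
      have : (k - 1 : ℝ) ≠ 0 := by linarith
      field_simp
      ring
    rw [e1] at h
    rw [e2]
    constructor <;> linarith [h.1, h.2]
  have hdeg : ∀ i : {v : V // v ≠ z}, ∑ e, x e * incN p q e i.1 = ((sgnX X i.1 * s i : ℤ) : ℝ) := by
    intro i
    have h := hxs i
    simp only [sgnX_inc p q X hp hq] at h
    push_cast at h ⊢
    rw [← h, Finset.mul_sum]
    refine Finset.sum_congr rfl fun e _ => ?_
    have : (sgnX X i.1 : ℝ) * sgnX X i.1 = 1 := by exact_mod_cast sgnX_sq X i.1
    linear_combination (-(x e * incN p q e i.1)) * this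
  have hmod : ∀ i : {v : V // v ≠ z}, ((sgnX X i.1 * s i : ℤ) : ZMod k) = g i.1 := by
    intro i
    have h := (ZMod.intCast_zmod_eq_zero_iff_dvd _ k).mpr (hs i)
    push_cast at h ⊢
    rw [sub_eq_zero.mp h, ← mul_assoc]
    have : (sgnX X i.1 : ZMod k) * sgnX X i.1 = 1 := by exact_mod_cast congrArg (Int.cast (R := ZMod k)) (sgnX_sq X i.1)
    rw [this]; simp
  refine ⟨x, fun e => by linarith [(hlo e).1], fun e => ?_, fun v => ?_⟩
  · have := (hlo e).2
    have h1 : (k : ℝ) / (2 * k - 2) ≤ 1 := by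
      rw [div_le_one (by linarith)]; linarith
    nlinarith
  · by_cases hv : v = z
    · subst hv
      refine ⟨-(sgnX X v * ∑ i : {w : V // w ≠ v}, sgnX X i.1 * (sgnX X i.1 * s i)), ?_, fun h => absurd rfl h, ?_⟩
      · push_cast
        have h2 : ∑ i : {w : V // w ≠ v}, (sgnX X i.1 : ZMod k) * ((sgnX X i.1 : ZMod k) * (s i : ZMod k)) =
            ∑ i : {w : V // w ≠ v}, (sgnX X i.1 : ZMod k) * g i.1 := by
          refine Finset.sum_congr rfl fun i _ => ?_
          rw [← hmod i]; push_cast; rfl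
        rw [h2]
        have h3 : (sgnX X v : ZMod k) * g v + ∑ i : {w : V // w ≠ v}, (sgnX X i.1 : ZMod k) * g i.1 = 0 := by
          rw [← hg, Fintype.sum_eq_add_sum_subtype_ne _ v]
        have : (sgnX X v : ZMod k) * sgnX X v = 1 := by exact_mod_cast congrArg (Int.cast (R := ZMod k)) (sgnX_sq X v)
        linear_combination (-(sgnX X v : ZMod k)) * h3 + g v * this
      · have h := sum_sgnX_deg p q X hp hq x
        rw [Fintype.sum_eq_add_sum_subtype_ne _ v] at h
        simp only [hdeg] at h
        have this : (sgnX X v : ℝ) * sgnX X v = 1 := by exact_mod_cast sgnX_sq X v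
        push_cast at h ⊢
        linear_combination (sgnX X v : ℝ) * h - (∑ e, x e * incN p q e v) * this
    · refine ⟨_, hmod ⟨v, hv⟩, fun _ => ?_, hdeg ⟨v, hv⟩⟩
      have hd : 2 * k - 2 ≤ ∑ e, incN p q e v := by
        have h := hW (LinearMap.ker (LinearMap.proj (R := ℝ) (φ := fun _ : {v : V // v ≠ z} => ℝ) ⟨v, hv⟩))
        have h1 := LinearMap.finrank_range_add_finrank_ker (LinearMap.proj (R := ℝ) (φ := fun _ : {v : V // v ≠ z} => ℝ) ⟨v, hv⟩)
        rw [LinearMap.range_eq_top.mpr (LinearMap.proj_surjective _), finrank_top, Module.finrank_self,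
          Module.finrank_fintype_fun_eq_card] at h1
        rw [← h1, mul_add, mul_one] at h
        have h2 : Nat.card {e : β // (fun i : {v : V // v ≠ z} => (((if p e = i.1 then 1 else 0) - (if q e = i.1 then 1 else 0) : ℤ) : ℝ)) ∉ (LinearMap.ker (LinearMap.proj (R := ℝ) (φ := fun _ : {v : V // v ≠ z} => ℝ) ⟨v, hv⟩))} ≤ ∑ e, incN p q e v := by
          rw [Nat.card_eq_fintype_card, Fintype.card_subtype, Finset.card_filter]
          refine Finset.sum_le_sum fun e _ => ?_
          split_ifs with hh
          · omega
          · simp only [LinearMap.mem_ker, LinearMap.proj_apply] at hh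
            unfold incN
            by_contra hcon
            apply hh
            have : ¬ p e = v ∧ ¬ q e = v := by
              constructor <;> intro h <;> apply hcon <;> simp [h]
            simp [this.1, this.2]
        omega
      have hd' : (2 * k - 2 : ℝ) ≤ ∑ e, (incN p q e v : ℝ) := by
        rw [← hKr]; exact_mod_cast hd
      set d : ℝ := ∑ e, (incN p q e v : ℝ) with hdd
      have hup : ∑ e, x e * incN p q e v ≤ (k / (2 * k - 2) - k * ξ / 2) * d := by
        rw [hdd, Finset.mul_sum]
        exact Finset.sum_le_sum fun e _ => mul_le_mul_of_nonneg_right (hlo e).2 (Nat.cast_nonneg _)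
      rw [hdeg ⟨v, hv⟩] at hup
      have hlt : ((sgnX X v * s ⟨v, hv⟩ : ℤ) : ℝ) < d - (k - 2) := by
        refine hup.trans_lt ?_
        have e3 : (k : ℝ) / (2 * k - 2) = 1 - (k - 2) / (2 * k - 2) := by
          have : (2 * k - 2 : ℝ) ≠ 0 := by linarith
          rw [eq_sub_iff_add_eq, ← add_div, div_eq_one_iff_eq this]; ring
        rw [e3]
        have e4 : (k - 2 : ℝ) ≤ (k - 2) / (2 * k - 2) * d := by
          rw [div_mul_eq_mul_div, le_div_iff₀ (by linarith)]
          exact mul_le_mul_of_nonneg_left hd' (by linarith)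
        have e5 : 0 < k * ξ / 2 * d := by
          have : 0 < d := by linarith
          positivity
        nlinarith
      have hlt2 : sgnX X v * s ⟨v, hv⟩ < ∑ e, (incN p q e v : ℤ) - (k - 2) := by
        rw [hdd] at hlt; exact_mod_cast hlt
      change sgnX X v * s ⟨v, hv⟩ ≤ _
      omega

theorem bip_factor_abs (p q : β → V) (X : Finset V) (hp : ∀ e, p e ∈ X) (hq : ∀ e, q e ∉ X)
    (k : ℕ) (hk : 2 ≤ k) (z : V)
    (hW : ∀ W : Submodule ℝ ({v : V // v ≠ z} → ℝ), (2 * k - 2) * Fintype.card {v : V // v ≠ z} ≤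
      (2 * k - 2) * Module.finrank ℝ W + Nat.card {e : β //
        (fun i : {v : V // v ≠ z} => (((if p e = i.1 then 1 else 0) - (if q e = i.1 then 1 else 0) : ℤ) : ℝ)) ∉ W})
    (g : V → ZMod k) (hg : ∑ v, (sgnX X v : ZMod k) * g v = 0) :
    ∃ S : Finset β, ∀ v, ((∑ e ∈ S, incN p q e v : ℕ) : ZMod k) = g v ∧
      (v ≠ z → ((∑ e ∈ S, incN p q e v : ℕ) : ℤ) ≤ ∑ e, (incN p q e v : ℤ) - (k - 1)) := by
  set A : V → Set ℤ := fun v => {n : ℤ | (n : ZMod k) = g v ∧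
      (v ≠ z → n ≤ ∑ e, (incN p q e v : ℤ) - (k - 1))} with hA
  set t : ℕ → Set (β → ℝ) := fun N => Set.Icc (fun _ => -(1 / (N + 1 : ℝ))) 1 ∩
    ⋂ v, (fun x : β → ℝ => ∑ e, x e * incN p q e v) ⁻¹' ((Int.cast : ℤ → ℝ) '' A v) with ht
  have hcl : ∀ N, IsClosed (t N) := by
    intro N
    refine isClosed_Icc.inter (isClosed_iInter fun v => ?_)
    refine IsClosed.preimage (by fun_prop) ?_
    exact Int.isClosedEmbedding_coe_real.isClosedMap _ (isClosed_discrete _)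
  have hne : (⋂ N, t N).Nonempty := by
    refine IsCompact.nonempty_iInter_of_sequence_nonempty_isCompact_isClosed t ?_ ?_ ?_ hcl
    · intro N
      refine Set.inter_subset_inter_left _ (Set.Icc_subset_Icc_left fun e => ?_)
      simp only [neg_le_neg_iff]
      push_cast
      apply one_div_le_one_div_of_le <;> linarith [(Nat.cast_nonneg N : (0 : ℝ) ≤ N)]
    · intro N
      obtain ⟨x, hx0, hx1, hx⟩ := frac_deg p q X hp hq k hk z hW g hg (1 / (N + 1 : ℝ)) (by positivity)
      refine ⟨x, ⟨fun e => hx0 e, fun e => hx1 e⟩, ?_⟩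
      simp only [Set.mem_iInter, Set.mem_preimage, Set.mem_image]
      intro v
      obtain ⟨n, h1, h2, h3⟩ := hx v
      exact ⟨n, ⟨h1, h2⟩, h3.symm⟩
    · exact isCompact_Icc.of_isClosed_subset (hcl 0) Set.inter_subset_left
  obtain ⟨x, hx⟩ := hne
  simp only [Set.mem_iInter] at hx
  have h0 : ∀ e, 0 ≤ x e := by
    intro e
    by_contra hlt
    push Not at hlt
    obtain ⟨N, hN⟩ := exists_nat_one_div_lt (show 0 < - x e by linarith)
    have := (hx N).1.1 e
    simp only at this
    linarith
  have h1 : ∀ e, x e ≤ 1 := fun e => (hx 0).1.2 e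
  have h2 : ∀ v, ∃ n ∈ A v, (n : ℝ) = ∑ e, x e * incN p q e v := by
    intro v
    have := (hx 0).2
    simp only [Set.mem_iInter, Set.mem_preimage, Set.mem_image] at this
    exact this v
  choose n hnA hn using h2
  obtain ⟨S, hS⟩ := round_deg p q X hp hq x h0 h1 n (fun v => (hn v).symm)
  refine ⟨S, fun v => ⟨?_, fun hv => ?_⟩⟩
  · rw [← (hnA v).1, ← hS v]; push_cast; rfl
  · rw [hS v]; exact (hnA v).2 hv

end PartC

section PartD
set_option linter.unusedSectionVars false

variable {V E : Type*} [Fintype V] [DecidableEq V] [Fintype E] [DecidableEq E]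

def tvec (z : V) (v : V) : {v : V // v ≠ z} → ℝ := fun i => if v = i.1 then 1 else 0

def dvec (ends : E → V × V) (z : V) (e : E) : {v : V // v ≠ z} → ℝ :=
  tvec z (ends e).1 - tvec z (ends e).2

open Classical in
/-- number of edges of `B` not in `W` -/
noncomputable def outW (ends : E → V × V) (z : V) (B : Finset E) (W : Submodule ℝ ({v : V // v ≠ z} → ℝ)) : ℕ :=
  (B.filter fun e => dvec ends z e ∉ W).card

def Rich (ends : E → V × V) (z : V) (K : ℕ) (B : Finset E) : Prop :=
  ∀ W : Submodule ℝ ({v : V // v ≠ z} → ℝ), K * Fintype.card {v : V // v ≠ z} ≤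
      K * Module.finrank ℝ W + outW ends z B W

lemma bip_factor (ends : E → V × V) (k : ℕ) (hk : 2 ≤ k) (z : V) (X : Finset V) (B : Finset E)
    (hB : BipartiteWrt ends B X) (hR : Rich ends z (2 * k - 2) B) (g : V → ZMod k)
    (hg : ∑ v, (sgnX X v : ZMod k) * g v = 0) :
    ∃ H ⊆ B, (∀ v, (mdeg ends H v : ZMod k) = g v) ∧
      ∀ v, v ≠ z → (mdeg ends H v : ℤ) ≤ mdeg ends B v - ((k : ℤ) - 1) := by
  classical
  set p : B → V := fun e => if (ends e.1).1 ∈ X then (ends e.1).1 else (ends e.1).2 with hp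
  set q : B → V := fun e => if (ends e.1).1 ∈ X then (ends e.1).2 else (ends e.1).1 with hq
  have hinc : ∀ (e : B) v, incN p q e v =
      (if (ends e.1).1 = v then 1 else 0) + (if (ends e.1).2 = v then 1 else 0) := by
    intro e v
    by_cases h : (ends e.1).1 ∈ X
    · simp only [incN, hp, hq, h, if_true]
    · simp only [incN, hp, hq, h, if_false]; rw [add_comm]
  have hpX : ∀ e, p e ∈ X := by
    intro e
    have := hB e.1 e.2
    by_cases h : (ends e.1).1 ∈ X
    · simp [hp, h]
    · simp only [hp, h, if_false]; tauto
  have hqX : ∀ e, q e ∉ X := by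
    intro e
    have := hB e.1 e.2
    by_cases h : (ends e.1).1 ∈ X
    · simp only [hq, h, if_true]; tauto
    · simp [hq, h]
  obtain ⟨S, hS⟩ := bip_factor_abs p q X hpX hqX k hk z (by
    intro W
    refine (hR W).trans (Nat.add_le_add_left (le_of_eq ?_) _)
    unfold outW
    rw [Nat.card_eq_fintype_card, Fintype.card_subtype]
    refine (Finset.card_bij (fun e _ => e.1) ?_ ?_ ?_).symm
    · intro e he
      simp only [mem_filter, mem_univ, true_and] at he ⊢
      refine ⟨e.2, fun h => he ?_⟩
      by_cases hX : (ends e.1).1 ∈ X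
      · convert h using 1
        ext i
        simp [hp, hq, hX, dvec, tvec]
      · convert W.neg_mem h using 1
        ext i
        simp [hp, hq, hX, dvec, tvec]
    · intro e _ e' _ h
      exact Subtype.ext h
    · intro e he
      simp only [mem_filter] at he
      refine ⟨⟨e, he.1⟩, ?_, rfl⟩
      simp only [mem_filter, mem_univ, true_and]
      intro h
      apply he.2
      by_cases hX : (ends e).1 ∈ X
      · convert h using 1
        ext i
        simp [hp, hq, hX, dvec, tvec]
      · convert W.neg_mem h using 1
        ext i
        simp [hp, hq, hX, dvec, tvec]) g hg
  have hdS : ∀ v, mdeg ends (S.map (Function.Embedding.subtype _)) v = ∑ e ∈ S, incN p q e v := by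
    intro v
    rw [mdeg, Finset.sum_map]
    exact Finset.sum_congr rfl fun e _ => (hinc e v).symm
  have hdB : ∀ v, mdeg ends B v = ∑ e, incN p q e v := by
    intro v
    rw [mdeg, ← Finset.sum_coe_sort]
    exact Finset.sum_congr rfl fun e _ => (hinc e v).symm
  refine ⟨S.map (Function.Embedding.subtype _), ?_, fun v => ?_, fun v hv => ?_⟩
  · intro e he
    simp only [Finset.mem_map, Function.Embedding.subtype_apply] at he
    obtain ⟨a, _, rfl⟩ := he
    exact a.2
  · rw [hdS]; exact (hS v).1
  · rw [hdS, hdB]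
    have := (hS v).2 hv
    push_cast at this ⊢
    exact this

lemma conn_outW (ends : E → V × V) (z : V) (T : Finset E) (hT : MConnected ends T)
    (W : Submodule ℝ ({v : V // v ≠ z} → ℝ)) :
    Fintype.card {v : V // v ≠ z} ≤ Module.finrank ℝ W + outW ends z T W := by
  classical
  set A : Finset ({v : V // v ≠ z} → ℝ) := (T.filter fun e => dvec ends z e ∉ W).image (dvec ends z) with hA
  set U := W ⊔ Submodule.span ℝ (A : Set ({v : V // v ≠ z} → ℝ)) with hU
  have hd : ∀ e ∈ T, dvec ends z e ∈ U := by
    intro e he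
    by_cases h : dvec ends z e ∈ W
    · exact Submodule.mem_sup_left h
    · refine Submodule.mem_sup_right (Submodule.subset_span ?_)
      simp only [hA, coe_image, coe_filter, Set.mem_image, Set.mem_ofPred_eq]
      exact ⟨e, ⟨he, h⟩, rfl⟩
  have ht : ∀ v, tvec z v ∈ U := by
    intro v
    have := hT z v
    induction this with
    | refl =>
      have : tvec z z = 0 := by
        ext i; simp [tvec, i.2.symm]
      rw [this]; exact U.zero_mem
    | tail _ h ih =>
      obtain ⟨e, he, h | h⟩ := h
      · have h2 := U.sub_mem ih (hd e he)
        simpa [dvec, h] using h2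
      · have h2 := U.add_mem (hd e he) ih
        simpa [dvec, h] using h2
  have htop : U = ⊤ := by
    rw [eq_top_iff, ← (Pi.basisFun ℝ {v : V // v ≠ z}).span_eq, Submodule.span_le]
    rintro _ ⟨i, rfl⟩
    have : (Pi.basisFun ℝ {v : V // v ≠ z}) i = tvec z i.1 := by
      ext j
      simp only [Pi.basisFun_apply, Pi.single_apply, tvec, Subtype.ext_iff]
      simp [eq_comm]
    rw [this]; exact ht _
  have h1 : Module.finrank ℝ U = Fintype.card {v : V // v ≠ z} := by
    rw [htop, finrank_top, Module.finrank_fintype_fun_eq_card]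
  rw [← h1]
  refine (Submodule.finrank_add_le_finrank_add_finrank _ _).trans (Nat.add_le_add_left ?_ _)
  exact (finrank_span_finset_le_card _).trans Finset.card_image_le

lemma rich_trees {α : Type*} [DecidableEq α] (ends : E → V × V) (z : V) (T : α → Finset E)
    (hT : ∀ i, IsSpanningTree ends (T i)) (hd : ∀ i j, i ≠ j → Disjoint (T i) (T j))
    (I : Finset α) (K : ℕ) (hK : K ≤ #I) : Rich ends z K (I.biUnion T) := by
  classical
  intro W
  obtain ⟨I', hI', rfl⟩ := Finset.exists_subset_card_eq hK
  have h1 : #I' * Fintype.card {v : V // v ≠ z} ≤ ∑ i ∈ I', (Module.finrank ℝ W + outW ends z (T i) W) := by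
    rw [← smul_eq_mul]
    exact Finset.card_nsmul_le_sum _ _ _ fun i _ => conn_outW ends z (T i) (hT i).1 W
  refine h1.trans ?_
  rw [Finset.sum_add_distrib, Finset.sum_const, smul_eq_mul]
  refine Nat.add_le_add_left ?_ _
  unfold outW
  rw [← Finset.card_biUnion]
  · refine Finset.card_le_card fun e he => ?_
    simp only [mem_biUnion, mem_filter] at he ⊢
    obtain ⟨i, hi, h⟩ := he
    exact ⟨⟨i, hI' hi, h.1⟩, h.2⟩
  · intro i _ j _ hij
    exact Finset.disjoint_filter_filter (hd i j hij)

/-- an edge crossing the cut -/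
def Crosses (ends : E → V × V) (X : Finset V) (e : E) : Prop :=
  ¬(((ends e).1 ∈ X) ↔ ((ends e).2 ∈ X))

instance (ends : E → V × V) (X : Finset V) : DecidablePred (Crosses ends X) := fun e => by
  unfold Crosses; infer_instance

lemma crosses_symmDiff (ends : E → V × V) (X C : Finset V) (e : E) :
    Crosses ends (symmDiff X C) e ↔
      (¬ Crosses ends X e ∧ Crosses ends C e) ∨ (Crosses ends X e ∧ ¬ Crosses ends C e) := by
  unfold Crosses
  simp only [Finset.mem_symmDiff]
  by_cases h1 : (ends e).1 ∈ X <;> by_cases h2 : (ends e).2 ∈ X <;>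
    by_cases h3 : (ends e).1 ∈ C <;> by_cases h4 : (ends e).2 ∈ C <;> simp [h1, h2, h3, h4]

lemma max_cut_outW (ends : E → V × V) (z : V) (G : Finset E) (X : Finset V)
    (hX : ∀ Y : Finset V, #(G.filter (Crosses ends Y)) ≤ #(G.filter (Crosses ends X)))
    (W : Submodule ℝ ({v : V // v ≠ z} → ℝ)) :
    outW ends z G W ≤ 2 * outW ends z (G.filter (Crosses ends X)) W := by
  classical
  set cl : V → (({v : V // v ≠ z} → ℝ) ⧸ W) := fun v => W.mkQ (tvec z v) with hcl
  have hW : ∀ e, dvec ends z e ∉ W ↔ cl (ends e).1 ≠ cl (ends e).2 := by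
    intro e
    rw [not_iff_not, ← sub_eq_zero, hcl]
    simp only
    rw [← map_sub, Submodule.mkQ_apply, Submodule.Quotient.mk_eq_zero]
    rfl
  set Q := (univ : Finset V).image cl with hQ
  set C : (({v : V // v ≠ z} → ℝ) ⧸ W) → Finset V := fun q => univ.filter fun v => cl v = q with hC
  have hflip : ∀ q, #((G.filter fun e => ¬ Crosses ends X e).filter (Crosses ends (C q))) ≤
      #((G.filter (Crosses ends X)).filter (Crosses ends (C q))) := by
    intro q
    have h := hX (symmDiff X (C q))
    have e1 : #(G.filter (Crosses ends X)) =
        #((G.filter (Crosses ends X)).filter (Crosses ends (C q))) +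
        #((G.filter (Crosses ends X)).filter fun e => ¬ Crosses ends (C q) e) :=
      (Finset.card_filter_add_card_filter_not _).symm
    have e2 : G.filter (Crosses ends (symmDiff X (C q))) =
        ((G.filter fun e => ¬ Crosses ends X e).filter (Crosses ends (C q))) ∪
        ((G.filter (Crosses ends X)).filter fun e => ¬ Crosses ends (C q) e) := by
      ext e
      have := crosses_symmDiff ends X (C q) e
      simp only [mem_union, mem_filter, this]
      clear this
      tauto
    rw [e2, Finset.card_union_of_disjoint] at h
    · omega
    · rw [Finset.disjoint_left]
      intro e he he'
      exact (Finset.mem_filter.mp (Finset.mem_filter.mp he).1).2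
        (Finset.mem_filter.mp (Finset.mem_filter.mp he').1).2
  have hcount : ∀ G' : Finset E, ∑ q ∈ Q, #(G'.filter (Crosses ends (C q))) = 2 * outW ends z G' W := by
    intro G'
    unfold outW
    simp_rw [Finset.card_filter]
    rw [Finset.sum_comm, Finset.mul_sum]
    refine Finset.sum_congr rfl fun e _ => ?_
    rw [← Finset.card_filter]
    by_cases h : cl (ends e).1 = cl (ends e).2
    · have : ¬ dvec ends z e ∉ W := by rw [hW]; simpa using h
      rw [if_neg this, mul_zero, Finset.card_eq_zero, Finset.filter_eq_empty_iff]
      intro q _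
      simp [Crosses, hC, h]
    · rw [if_pos ((hW e).2 h)]
      have : Q.filter (fun q => Crosses ends (C q) e) = {cl (ends e).1, cl (ends e).2} := by
        ext q
        simp only [mem_filter, hQ, mem_image, mem_univ, true_and, Crosses, hC, mem_insert,
          mem_singleton]
        constructor
        · rintro ⟨_, h2⟩
          by_contra hcon
          push Not at hcon
          exact h2 ⟨fun h => absurd h.symm hcon.1, fun h => absurd h.symm hcon.2⟩
        · rintro (rfl | rfl)
          · exact ⟨⟨_, rfl⟩, fun hh => h (hh.1 rfl).symm⟩
          · exact ⟨⟨_, rfl⟩, fun hh => h (hh.2 rfl)⟩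
      rw [this, Finset.card_pair h, mul_one]
  have hle : outW ends z (G.filter fun e => ¬ Crosses ends X e) W ≤ outW ends z (G.filter (Crosses ends X)) W := by
    have := Finset.sum_le_sum fun q (_ : q ∈ Q) => hflip q
    rw [hcount, hcount] at this
    omega
  have hsplit : outW ends z G W = outW ends z (G.filter (Crosses ends X)) W +
      outW ends z (G.filter fun e => ¬ Crosses ends X e) W := by
    unfold outW
    rw [← Finset.card_filter_add_card_filter_not (s := G.filter fun e => dvec ends z e ∉ W) (Crosses ends X)]
    rw [Finset.filter_comm, Finset.filter_comm (p := fun e => dvec ends z e ∉ W) (q := fun e => ¬ Crosses ends X e)]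
  omega

end PartD

section PartD2
set_option linter.unusedSectionVars false

variable {V E : Type*} [Fintype V] [DecidableEq V] [Fintype E] [DecidableEq E]

lemma mdeg_union (ends : E → V × V) (S T : Finset E) (h : Disjoint S T) (v : V) :
    mdeg ends (S ∪ T) v = mdeg ends S v + mdeg ends T v := by
  unfold mdeg; exact Finset.sum_union h

lemma mdeg_mono (ends : E → V × V) (S T : Finset E) (h : S ⊆ T) (v : V) :
    mdeg ends S v ≤ mdeg ends T v := by
  unfold mdeg; exact Finset.sum_le_sum_of_subset h

lemma sum_sgn_mdeg (ends : E → V × V) (X : Finset V) (S : Finset E) :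
    ∑ v, sgnX X v * (mdeg ends S v : ℤ) = ∑ e ∈ S, (sgnX X (ends e).1 + sgnX X (ends e).2) := by
  unfold mdeg
  push_cast
  simp_rw [Finset.mul_sum]
  rw [Finset.sum_comm]
  refine Finset.sum_congr rfl fun e _ => ?_
  simp [mul_add, Finset.sum_add_distrib]

lemma sgn_crosses (ends : E → V × V) (X : Finset V) (e : E) (h : Crosses ends X e) :
    sgnX X (ends e).1 + sgnX X (ends e).2 = 0 := by
  unfold Crosses at h
  unfold sgnX
  by_cases h1 : (ends e).1 ∈ X <;> by_cases h2 : (ends e).2 ∈ X <;> simp_all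

lemma sgn_not_crosses (ends : E → V × V) (X : Finset V) (e : E) (h : ¬ Crosses ends X e) :
    sgnX X (ends e).1 + sgnX X (ends e).2 = 2 * sgnX X (ends e).1 := by
  unfold Crosses at h
  unfold sgnX
  by_cases h1 : (ends e).1 ∈ X <;> by_cases h2 : (ends e).2 ∈ X <;> simp_all

lemma sum_sgn_mdeg_inner (ends : E → V × V) (X : Finset V) (S J : Finset E)
    (hJ : S.filter (fun e => ¬ Crosses ends X e) = J) :
    ∑ v, sgnX X v * (mdeg ends S v : ℤ) = 2 * ∑ e ∈ J, sgnX X (ends e).1 := by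
  rw [sum_sgn_mdeg, ← Finset.sum_filter_add_sum_filter_not S (Crosses ends X), hJ,
    Finset.sum_eq_zero, zero_add, Finset.mul_sum]
  · refine Finset.sum_congr rfl fun e he => ?_
    rw [← hJ] at he
    exact sgn_not_crosses ends X e (Finset.mem_filter.mp he).2
  · intro e he
    exact sgn_crosses ends X e (Finset.mem_filter.mp he).2

lemma assembly {α : Type*} (ends : E → V × V) (k m m₀ : ℕ) (hk : 2 ≤ k) (z : V)
    (f : V → ZMod k) (T : α → Finset E)
    (hT : ∀ i, IsSpanningTree ends (T i)) (hd : ∀ i j, i ≠ j → Disjoint (T i) (T j))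
    (a : Fin m → α) (c : Fin m₀ → α) (ha : Function.Injective a) (hc : Function.Injective c)
    (hac : ∀ i j, a i ≠ c j) (X : Finset V) (J B : Finset E)
    (hJ : ∀ e ∈ J, ¬ Crosses ends X e) (hB : ∀ e ∈ B, Crosses ends X e)
    (hBa : ∀ i, Disjoint B (T (a i))) (hBc : ∀ i, Disjoint B (T (c i)))
    (hJ1 : ∀ i, ∀ e ∈ T (a i), ¬ Crosses ends X e → e ∈ J)
    (hJ2 : ∀ i, ∀ e ∈ T (c i), e ∉ J)
    (hR : Rich ends z (2 * k - 2) B)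
    (hs : ∑ v, (sgnX X v : ZMod k) * f v = ((2 * ∑ e ∈ J, sgnX X (ends e).1 : ℤ) : ZMod k)) :
    ∃ H : Finset E, TreeConnected ends m H ∧
      TreeConnected ends m₀ ((Finset.univ : Finset E) \ H) ∧
      (∀ v, (mdeg ends H v : ZMod k) = f v) ∧
      ∀ v, v ≠ z → (mdeg ends H v : ℤ)
        ≤ (mdeg ends (Finset.univ : Finset E) v : ℤ) - ((k : ℤ) - 1) := by
  set U : Finset E := (univ.biUnion fun i => T (a i)) ∪ J with hU
  have hUB : Disjoint U B := by
    rw [hU, Finset.disjoint_union_left, Finset.disjoint_biUnion_left]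
    refine ⟨fun i _ => (hBa i).symm, ?_⟩
    rw [Finset.disjoint_left]
    exact fun e h1 h2 => hJ e h1 (hB e h2)
  have hUJ : U.filter (fun e => ¬ Crosses ends X e) = J := by
    ext e
    simp only [hU, mem_filter, mem_union, mem_biUnion, mem_univ, true_and]
    constructor
    · rintro ⟨⟨i, hi⟩ | h, h2⟩
      · exact hJ1 i e hi h2
      · exact h
    · exact fun h => ⟨Or.inr h, hJ e h⟩
  have h1 := sum_sgn_mdeg_inner ends X U J hUJ
  obtain ⟨H, hHB, hH1, hH2⟩ := bip_factor ends k hk z X B hB hR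
    (fun v => f v - (mdeg ends U v : ZMod k)) (by
      have h2 := congrArg (Int.cast : ℤ → ZMod k) h1
      push_cast at h2 hs
      simp only [mul_sub, Finset.sum_sub_distrib]
      rw [hs, h2, sub_self])
  have hUH : Disjoint U H := hUB.mono_right hHB
  refine ⟨U ∪ H, ⟨fun i => T (a i), fun i => ⟨?_, hT _⟩, fun i j hij => hd _ _ (ha.ne hij)⟩,
    ⟨fun i => T (c i), fun i => ⟨?_, hT _⟩, fun i j hij => hd _ _ (hc.ne hij)⟩, fun v => ?_,
    fun v hv => ?_⟩
  · intro e he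
    simp only [hU, mem_union, mem_biUnion, mem_univ, true_and]
    exact Or.inl (Or.inl ⟨i, he⟩)
  · intro e he
    simp only [hU, mem_sdiff, mem_union, mem_biUnion, mem_univ, true_and]
    rintro ((⟨j, hj⟩ | h) | h)
    · exact Finset.disjoint_left.mp (hd _ _ (hac j i)) hj he
    · exact hJ2 i e he h
    · exact Finset.disjoint_left.mp (hBc i) (hHB h) he
  · rw [mdeg_union ends U H hUH, Nat.cast_add, hH1]; ring
  · rw [mdeg_union ends U H hUH]
    have h3 := mdeg_mono ends (U ∪ B) univ (Finset.subset_univ _) v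
    rw [mdeg_union ends U B hUB] at h3
    have h4 := hH2 v hv
    push_cast
    omega

lemma compat_sum (ends : E → V × V) {k : ℕ} (f : V → ZMod k) (X : Finset V)
    (h : CompatibleWrt ends (univ : Finset E) f X) :
    ∃ x : ℤ, -(eIn ends univ Xᶜ : ℤ) ≤ x ∧ x ≤ eIn ends univ X ∧
      ∑ v, (sgnX X v : ZMod k) * f v = ((2 * x : ℤ) : ZMod k) := by
  have h0 : ∑ v, (sgnX X v : ZMod k) * f v = ∑ v ∈ X, f v - ∑ v ∈ Xᶜ, f v := by
    rw [← Finset.sum_add_sum_compl X, sub_eq_add_neg, ← Finset.sum_neg_distrib]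
    congr 1
    · refine Finset.sum_congr rfl fun v hv => ?_
      simp [sgnX, hv]
    · refine Finset.sum_congr rfl fun v hv => ?_
      simp [sgnX, Finset.mem_compl.mp hv]
  rcases h with ⟨x, hx, h⟩ | ⟨y, hy, h⟩
  · refine ⟨x, by omega, by exact_mod_cast hx, ?_⟩
    rw [h0, ← h]; push_cast; ring
  · refine ⟨-y, by omega, by omega, ?_⟩
    rw [h0, h]; push_cast; ring

lemma flip_up (I : Finset E) (w : E → ℤ) (hw : ∀ e ∈ I, w e = 1 ∨ w e = -1) (J0 : Finset E)
    (hJ0 : J0 ⊆ I) (d : ℕ) (ht : ∑ e ∈ J0, w e + d ≤ #(I.filter fun e => w e = 1)) :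
    ∃ J ⊆ I, #(symmDiff J J0) = d ∧ ∑ e ∈ J, w e = ∑ e ∈ J0, w e + d := by
  set F := I.filter fun e => (w e = 1 ∧ e ∉ J0) ∨ (w e = -1 ∧ e ∈ J0) with hF
  have key : ∀ D ⊆ F, ∑ e ∈ symmDiff D J0, w e = ∑ e ∈ J0, w e + #D := by
    intro D hD
    have e1 : ∑ e ∈ symmDiff D J0, w e = ∑ e ∈ D \ J0, w e + ∑ e ∈ J0 \ D, w e := by
      rw [symmDiff_def, Finset.sup_eq_union, Finset.sum_union disjoint_sdiff_sdiff]
    have e2 : ∑ e ∈ D \ J0, w e = #(D \ J0) := by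
      rw [Finset.sum_congr rfl (g := fun _ => (1 : ℤ))]
      · simp
      · intro e he
        have h1 := hD (Finset.mem_sdiff.mp he).1
        have h2 := (Finset.mem_sdiff.mp he).2
        rw [hF, Finset.mem_filter] at h1
        tauto
    have e3 : ∑ e ∈ J0 ∩ D, w e = -#(J0 ∩ D) := by
      rw [Finset.sum_congr rfl (g := fun _ => (-1 : ℤ))]
      · simp
      · intro e he
        have h1 := hD (Finset.mem_inter.mp he).2
        have h2 := (Finset.mem_inter.mp he).1
        rw [hF, Finset.mem_filter] at h1
        tauto
    have e4 := Finset.sum_inter_add_sum_sdiff J0 D w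
    have e5 := Finset.card_inter_add_card_sdiff D J0
    rw [Finset.inter_comm] at e5
    omega
  have hFc : (d : ℤ) ≤ #F := by
    have h1 := key F subset_rfl
    have h2 : symmDiff F J0 = I.filter fun e => w e = 1 := by
      ext e
      simp only [Finset.mem_symmDiff, hF, mem_filter]
      have := @hJ0 e
      have h3 := hw e
      by_cases h5 : e ∈ I
      · rcases h3 h5 with h | h
        · simp only [h, h5]
          norm_num
          tauto
        · simp only [h, h5]
          norm_num
      · tauto
    have h3 : ∑ e ∈ I.filter (fun e => w e = 1), w e = #(I.filter fun e => w e = 1) := by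
      rw [Finset.sum_congr rfl (g := fun _ => (1 : ℤ))]
      · simp
      · intro e he
        exact (Finset.mem_filter.mp he).2
    rw [h2, h3] at h1
    omega
  obtain ⟨D, hD, hDd⟩ := Finset.exists_subset_card_eq (by exact_mod_cast hFc : d ≤ #F)
  refine ⟨symmDiff D J0, ?_, ?_, ?_⟩
  · intro e he
    rw [Finset.mem_symmDiff] at he
    rcases he with h | h
    · exact (Finset.mem_filter.mp (hD h.1)).1
    · exact hJ0 h.1
  · rw [symmDiff_symmDiff_cancel_right, hDd]
  · rw [key D hD, hDd]

lemma flip_any (I : Finset E) (w : E → ℤ) (hw : ∀ e ∈ I, w e = 1 ∨ w e = -1) (J0 : Finset E)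
    (hJ0 : J0 ⊆ I) (t : ℤ)
    (ht : (∑ e ∈ J0, w e ≤ t ∧ t ≤ #(I.filter fun e => w e = 1)) ∨
      (t ≤ ∑ e ∈ J0, w e ∧ -(#(I.filter fun e => w e = -1) : ℤ) ≤ t)) :
    ∃ J ⊆ I, (#(symmDiff J J0) : ℤ) = |t - ∑ e ∈ J0, w e| ∧ ∑ e ∈ J, w e = t := by
  rcases ht with ⟨h, ht⟩ | ⟨h, ht⟩
  · obtain ⟨d, hd⟩ := Int.eq_ofNat_of_zero_le (sub_nonneg.2 h)
    obtain ⟨J, h1, h2, h3⟩ := flip_up I w hw J0 hJ0 d (by omega)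
    refine ⟨J, h1, ?_, by omega⟩
    rw [abs_of_nonneg (by omega), h2]; omega
  · obtain ⟨d, hd⟩ := Int.eq_ofNat_of_zero_le (sub_nonneg.2 h)
    obtain ⟨J, h1, h2, h3⟩ := flip_up I (fun e => - w e) (by
      intro e he
      rcases hw e he with h | h <;> simp [h]) J0 hJ0 d (by
      rw [Finset.sum_neg_distrib]
      simp only [neg_eq_iff_eq_neg]
      omega)
    rw [Finset.sum_neg_distrib, Finset.sum_neg_distrib] at h3
    refine ⟨J, h1, ?_, by omega⟩
    rw [abs_of_nonpos (by omega), h2]; omega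

end PartD2

section PartD3
set_option linter.unusedSectionVars false

variable {V E : Type*} [Fintype V] [DecidableEq V] [Fintype E] [DecidableEq E]

lemma tree_index (ends : E → V × V) (N m m₀ r : ℕ) (hN : N = m + m₀ + r)
    (h : TreeConnected ends N (univ : Finset E)) :
    ∃ T : (Fin m ⊕ Fin m₀) ⊕ Fin r → Finset E, (∀ i, IsSpanningTree ends (T i)) ∧
      ∀ i j, i ≠ j → Disjoint (T i) (T j) := by
  subst hN
  obtain ⟨T, h1, h2⟩ := h
  let φ : (Fin m ⊕ Fin m₀) ⊕ Fin r ≃ Fin (m + m₀ + r) :=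
    (Equiv.sumCongr finSumFinEquiv (Equiv.refl _)).trans finSumFinEquiv
  exact ⟨fun i => T (φ i), fun i => (h1 _).2, fun i j hij => h2 _ _ (φ.injective.ne hij)⟩

lemma card_meets {α β : Type*} (T : α → Finset E)
    (hd : ∀ i j, i ≠ j → Disjoint (T i) (T j)) (ι : β → α) (hι : Function.Injective ι)
    (S : Finset β) (F : Finset E) (h : ∀ i ∈ S, ∃ e ∈ F, e ∈ T (ι i)) : #S ≤ #F := by
  classical
  rcases S.eq_empty_or_nonempty with rfl | ⟨i0, hi0⟩
  · simp
  have : Nonempty E := ⟨(h i0 hi0).choose⟩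
  choose! g hg1 hg2 using h
  refine Finset.card_le_card_of_injOn g hg1 ?_
  intro i hi j hj hij
  by_contra hne
  have h1 := hg2 i hi
  have h2 := hg2 j hj
  rw [hij] at h1
  exact Finset.disjoint_left.mp (hd _ _ (hι.ne hne)) h1 h2

lemma disj_biUnion {α : Type*} [DecidableEq α] (T : α → Finset E)
    (hd : ∀ i j, i ≠ j → Disjoint (T i) (T j)) (I : Finset α) (i : α) (hi : i ∉ I) :
    Disjoint (I.biUnion T) (T i) := by
  rw [Finset.disjoint_biUnion_left]
  intro j hj
  exact hd _ _ (fun h => hi (h ▸ hj))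

lemma bip_case (ends : E → V × V) (k m m₀ : ℕ) (hk : 2 ≤ k) (z : V)
    (f : V → ZMod k) (hf : Compatible ends (Finset.univ : Finset E) f)
    (X : Finset V) (hX : BipartiteWrt ends (univ : Finset E) X)
    (hG : TreeConnected ends (m + m₀ + 2 * k - 2) (Finset.univ : Finset E)) :
    ∃ H : Finset E, TreeConnected ends m H ∧
      TreeConnected ends m₀ ((Finset.univ : Finset E) \ H) ∧
      (∀ v, (mdeg ends H v : ZMod k) = f v) ∧
      ∀ v, v ≠ z → (mdeg ends H v : ℤ)
        ≤ (mdeg ends (Finset.univ : Finset E) v : ℤ) - ((k : ℤ) - 1) := by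
  obtain ⟨T, hT, hd⟩ := tree_index ends _ m m₀ (2 * k - 2) (by omega) hG
  have hcr : ∀ e, Crosses ends X e := fun e => hX e (mem_univ _)
  obtain ⟨x, hx1, hx2, hx⟩ := compat_sum ends f X (hf X)
  have e1 : eIn ends univ X = 0 := by
    rw [eIn, Finset.card_eq_zero, Finset.filter_eq_empty_iff]
    intro e _ h
    exact hcr e (by tauto)
  have e2 : eIn ends univ Xᶜ = 0 := by
    rw [eIn, Finset.card_eq_zero, Finset.filter_eq_empty_iff]
    intro e _ h
    simp only [mem_compl] at h
    exact hcr e (by tauto)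
  have hx0 : x = 0 := by omega
  subst hx0
  refine assembly ends k m m₀ hk z f T hT hd (fun i => Sum.inl (Sum.inl i))
    (fun i => Sum.inl (Sum.inr i)) (fun i j h => by simpa using h) (fun i j h => by simpa using h)
    (fun i j h => by simp at h) X ∅ (((univ : Finset (Fin (2 * k - 2))).image Sum.inr).biUnion T)
    (by simp) (fun e _ => hcr e) (fun i => disj_biUnion T hd _ _ (by simp))
    (fun i => disj_biUnion T hd _ _ (by simp)) (fun i e _ h => absurd (hcr e) h) (by simp)
    (rich_trees ends z T hT hd _ _ ?_) ?_
  · rw [Finset.card_image_of_injective _ Sum.inr_injective]; simp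
  · rw [hx]; simp

lemma gen_case (ends : E → V × V) (k m m₀ : ℕ) (hk : 2 ≤ k) (z : V)
    (f : V → ZMod k) (hf : Compatible ends (Finset.univ : Finset E) f)
    (hG : TreeConnected ends (m + m₀ + 4 * k - 4) (Finset.univ : Finset E)) :
    ∃ H : Finset E, TreeConnected ends m H ∧
      TreeConnected ends m₀ ((Finset.univ : Finset E) \ H) ∧
      (∀ v, (mdeg ends H v : ZMod k) = f v) ∧
      ∀ v, v ≠ z → (mdeg ends H v : ℤ)
        ≤ (mdeg ends (Finset.univ : Finset E) v : ℤ) - ((k : ℤ) - 1) := by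
  classical
  obtain ⟨T, hT, hd⟩ := tree_index ends _ m m₀ (4 * k - 4) (by omega) hG
  set G : Finset E := ((univ : Finset (Fin (4 * k - 4))).image Sum.inr).biUnion T with hGdef
  have hRG : Rich ends z (4 * k - 4) G := by
    refine rich_trees ends z T hT hd _ _ ?_
    rw [Finset.card_image_of_injective _ Sum.inr_injective]; simp
  obtain ⟨X, -, hX⟩ := Finset.exists_max_image (univ : Finset (Finset V))
    (fun Y => #(G.filter (Crosses ends Y))) ⟨∅, mem_univ _⟩
  obtain ⟨x, hx1, hx2, hx⟩ := compat_sum ends f X (hf X)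
  set w : E → ℤ := fun e => sgnX X (ends e).1 with hw
  have hw1 : ∀ e, w e = 1 ∨ w e = -1 := by
    intro e
    simp only [hw, sgnX]
    split_ifs <;> simp
  set In : Finset E := univ.filter fun e => ¬ Crosses ends X e with hIn
  have hpos : #(In.filter fun e => w e = 1) = eIn ends univ X := by
    rw [eIn]
    congr 1
    ext e
    simp only [hIn, hw, sgnX, Crosses, mem_filter, mem_univ, true_and]
    by_cases h1 : (ends e).1 ∈ X <;> by_cases h2 : (ends e).2 ∈ X <;> simp [h1, h2]
  have hneg : #(In.filter fun e => w e = -1) = eIn ends univ Xᶜ := by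
    rw [eIn]
    congr 1
    ext e
    simp only [hIn, hw, sgnX, Crosses, mem_filter, mem_univ, true_and, mem_compl]
    by_cases h1 : (ends e).1 ∈ X <;> by_cases h2 : (ends e).2 ∈ X <;> simp [h1, h2]
  set J0 : Finset E := ((univ : Finset (Fin m)).biUnion fun i => T (Sum.inl (Sum.inl i))).filter
    fun e => ¬ Crosses ends X e with hJ0
  have hJ0m : ∀ e, e ∈ J0 ↔ (∃ i, e ∈ T (Sum.inl (Sum.inl i))) ∧ ¬ Crosses ends X e := by
    intro e; simp [hJ0]
  have hJ0c : ∀ j, ∀ e ∈ T (Sum.inl (Sum.inr j)), e ∉ J0 := by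
    intro j e he h
    obtain ⟨⟨i, hi⟩, -⟩ := (hJ0m e).1 h
    exact Finset.disjoint_left.mp (hd _ _ (by simp)) hi he
  set s0 : ℤ := ∑ e ∈ J0, w e with hs0
  set Fr : Finset E := univ.filter fun e => ¬ Crosses ends X e ∧ ∀ i, e ∉ T (Sum.inl i) with hFr
  have hFrm : ∀ e, e ∈ Fr ↔ ¬ Crosses ends X e ∧ ∀ i, e ∉ T (Sum.inl i) := by
    intro e; simp [hFr]
  by_cases hc : k - 1 ≤ #Fr
  · set n := #(Fr.filter fun e => w e = -1) with hn
    have hpn : #(Fr.filter fun e => w e = 1) + n = #Fr := by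
      rw [← Finset.card_filter_add_card_filter_not (s := Fr) (fun e => w e = 1), hn]
      congr 2
      ext e
      simp only [mem_filter]
      rcases hw1 e with h | h <;> simp [h]
    set t : ℤ := -n + (x - s0 + n) % k with ht
    have hm1 := Int.emod_nonneg (x - s0 + n) (b := (k : ℤ)) (by omega)
    have hm2 := Int.emod_lt_of_pos (x - s0 + n) (b := (k : ℤ)) (by omega)
    have hm3 := Int.emod_add_mul_ediv (x - s0 + n) k
    obtain ⟨J1, hJ1, -, hJ1s⟩ := flip_any Fr w (fun e _ => hw1 e) ∅ (by simp) t (by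
      simp only [Finset.sum_empty]
      omega)
    have hdis : Disjoint J0 J1 := by
      rw [Finset.disjoint_left]
      intro e h1 h2
      obtain ⟨⟨i, hi⟩, -⟩ := (hJ0m e).1 h1
      exact ((hFrm e).1 (hJ1 h2)).2 _ hi
    refine assembly ends k m m₀ hk z f T hT hd (fun i => Sum.inl (Sum.inl i))
      (fun i => Sum.inl (Sum.inr i)) (fun i j h => by simpa using h)
      (fun i j h => by simpa using h)
      (fun i j h => by simp at h) X (J0 ∪ J1) (G.filter (Crosses ends X))
      ?_ (fun e he => (Finset.mem_filter.mp he).2)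
      (fun i => (disj_biUnion T hd _ _ (by simp)).mono_left (Finset.filter_subset _ _))
      (fun i => (disj_biUnion T hd _ _ (by simp)).mono_left (Finset.filter_subset _ _))
      (fun i e h1 h2 => Finset.mem_union_left _ ((hJ0m e).2 ⟨⟨i, h1⟩, h2⟩)) ?_ ?_ ?_
    · intro e he
      rcases Finset.mem_union.mp he with h | h
      · exact ((hJ0m e).1 h).2
      · exact ((hFrm e).1 (hJ1 h)).1
    · intro j e he h
      rcases Finset.mem_union.mp h with h | h
      · exact hJ0c j e he h
      · exact ((hFrm e).1 (hJ1 h)).2 _ he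
    · intro W
      have h1 := hRG W
      have h2 := max_cut_outW ends z G X (fun Y => hX Y (mem_univ _)) W
      have h3 : 4 * k - 4 = 2 * (2 * k - 2) := by omega
      rw [h3, mul_assoc, mul_assoc] at h1
      omega
    · rw [hx, Finset.sum_union hdis]
      change _ = ((2 * (s0 + ∑ e ∈ J1, w e) : ℤ) : ZMod k)
      rw [hJ1s]
      have : x = s0 + t + k * ((x - s0 + n) / k) := by omega
      rw [this]
      push_cast
      simp
  · obtain ⟨t, q, htq, htd, htb⟩ : ∃ t q : ℤ, x = t + k * q ∧ |t - s0| ≤ (k : ℤ) - 1 ∧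
        ((s0 ≤ t ∧ t ≤ #(In.filter fun e => w e = 1)) ∨
        (t ≤ s0 ∧ -(#(In.filter fun e => w e = -1) : ℤ) ≤ t)) := by
      rw [hpos, hneg]
      rcases le_total s0 x with h | h
      · have hm1 := Int.emod_nonneg (x - s0) (b := (k : ℤ)) (by omega)
        have hm2 := Int.emod_lt_of_pos (x - s0) (b := (k : ℤ)) (by omega)
        have hm3 := Int.emod_add_mul_ediv (x - s0) k
        have hm4 : 0 ≤ (k : ℤ) * ((x - s0) / k) :=
          mul_nonneg (by omega) (Int.ediv_nonneg (sub_nonneg.2 h) (by omega))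
        refine ⟨s0 + (x - s0) % k, (x - s0) / k, by omega, ?_, Or.inl ⟨by omega, by omega⟩⟩
        rw [abs_le]; constructor <;> omega
      · have hm1 := Int.emod_nonneg (s0 - x) (b := (k : ℤ)) (by omega)
        have hm2 := Int.emod_lt_of_pos (s0 - x) (b := (k : ℤ)) (by omega)
        have hm3 := Int.emod_add_mul_ediv (s0 - x) k
        have hm4 : 0 ≤ (k : ℤ) * ((s0 - x) / k) :=
          mul_nonneg (by omega) (Int.ediv_nonneg (sub_nonneg.2 h) (by omega))
        refine ⟨s0 - (s0 - x) % k, -((s0 - x) / k), by rw [mul_neg]; omega, ?_,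
          Or.inr ⟨by omega, by omega⟩⟩
        rw [abs_le]; constructor <;> omega
    obtain ⟨J, hJ, hJd, hJs⟩ := flip_any In w (fun e _ => hw1 e) J0
      (fun e he => by simp [hIn, ((hJ0m e).1 he).2]) t htb
    rw [← hs0] at hJd
    set D := symmDiff J J0 with hD
    have hDk : #D ≤ k - 1 := by omega
    have hJD : ∀ e, e ∉ D → (e ∈ J ↔ e ∈ J0) := by
      intro e he
      rw [hD, Finset.mem_symmDiff] at he
      tauto
    have hJc : ∀ e ∈ J, ¬ Crosses ends X e := fun e he => by
      have := hJ he
      simpa [hIn] using this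
    set Rc : Finset (Fin (4 * k - 4)) := univ.filter fun r => ∀ e ∈ T (Sum.inr r), Crosses ends X e
      with hRc
    have hRcc : 3 * k - 2 ≤ #Rc := by
      have h1 := Finset.card_filter_add_card_filter_not (s := (univ : Finset (Fin (4 * k - 4))))
        (fun r => ∀ e ∈ T (Sum.inr r), Crosses ends X e)
      have h2 : #((univ : Finset (Fin (4 * k - 4))).filter
          fun r => ¬ ∀ e ∈ T (Sum.inr r), Crosses ends X e) ≤ #Fr := by
        refine card_meets T hd Sum.inr Sum.inr_injective _ _ ?_
        intro r hr
        have h3 := (Finset.mem_filter.mp hr).2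
        push Not at h3
        obtain ⟨e, he, hce⟩ := h3
        refine ⟨e, (hFrm e).2 ⟨hce, fun i hi => ?_⟩, he⟩
        exact Finset.disjoint_left.mp (hd _ _ (by simp)) hi he
      rw [Finset.card_univ, Fintype.card_fin, ← hRc] at h1
      omega
    set Bad : Finset (Fin m ⊕ Fin m₀) := univ.filter fun i => ∃ e ∈ D, e ∈ T (Sum.inl i) with hBad
    have hBadc : #Bad ≤ k - 1 :=
      (card_meets T hd Sum.inl Sum.inl_injective Bad D
        (fun i hi => (Finset.mem_filter.mp hi).2)).trans hDk
    obtain ⟨φ⟩ := Function.Embedding.nonempty_of_card_le (α := Bad) (β := Rc) (by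
      rw [Fintype.card_coe, Fintype.card_coe]; omega)
    set used : Finset (Fin (4 * k - 4)) := univ.image fun b => (φ b).1 with hused
    have husedc : #used ≤ k - 1 := by
      refine Finset.card_image_le.trans ?_
      rw [Finset.card_univ, Fintype.card_coe]; exact hBadc
    set ψ : Fin m ⊕ Fin m₀ → (Fin m ⊕ Fin m₀) ⊕ Fin (4 * k - 4) := fun i =>
      if h : i ∈ Bad then Sum.inr (φ ⟨i, h⟩).1 else Sum.inl i with hψ
    have hψ1 : ∀ i (h : i ∈ Bad), ψ i = Sum.inr (φ ⟨i, h⟩).1 := fun i h => by simp [hψ, h]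
    have hψ2 : ∀ i (h : i ∉ Bad), ψ i = Sum.inl i := fun i h => by simp [hψ, h]
    have hψi : Function.Injective ψ := by
      intro i j hij
      by_cases hi : i ∈ Bad <;> by_cases hj : j ∈ Bad
      · rw [hψ1 i hi, hψ1 j hj] at hij
        have := φ.injective (Subtype.ext (Sum.inr_injective hij))
        exact congrArg Subtype.val this
      · rw [hψ1 i hi, hψ2 j hj] at hij; simp at hij
      · rw [hψ2 i hi, hψ1 j hj] at hij; simp at hij
      · rw [hψ2 i hi, hψ2 j hj] at hij; exact Sum.inl_injective hij
    have hbadcr : ∀ i (h : i ∈ Bad), ∀ e ∈ T (ψ i), Crosses ends X e := by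
      intro i h e he
      rw [hψ1 i h] at he
      exact (Finset.mem_filter.mp (φ ⟨i, h⟩).2).2 e he
    have hgood : ∀ i (h : i ∉ Bad), ∀ e ∈ T (ψ i), e ∈ T (Sum.inl i) ∧ (e ∈ J ↔ e ∈ J0) := by
      intro i h e he
      rw [hψ2 i h] at he
      refine ⟨he, hJD e fun h1 => h ?_⟩
      simp only [hBad, mem_filter, mem_univ, true_and]
      exact ⟨e, h1, he⟩
    have hψB : ∀ i, ψ i ∉ (Rc \ used).image Sum.inr := by
      intro i hi
      by_cases h : i ∈ Bad
      · rw [hψ1 i h, Finset.mem_image] at hi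
        obtain ⟨r, hr, hr2⟩ := hi
        have := Sum.inr_injective hr2
        apply (Finset.mem_sdiff.mp hr).2
        rw [this, hused]
        exact Finset.mem_image_of_mem _ (mem_univ _)
      · rw [hψ2 i h] at hi; simp at hi
    refine assembly ends k m m₀ hk z f T hT hd (fun i => ψ (Sum.inl i))
      (fun i => ψ (Sum.inr i)) (fun i j h => Sum.inl_injective (hψi h))
      (fun i j h => Sum.inr_injective (hψi h))
      (fun i j h => by have := hψi h; simp at this) X J (((Rc \ used).image Sum.inr).biUnion T)
      hJc ?_ (fun i => disj_biUnion T hd _ _ (hψB _)) (fun i => disj_biUnion T hd _ _ (hψB _))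
      ?_ ?_ (rich_trees ends z T hT hd _ _ ?_) ?_
    · intro e he
      simp only [mem_biUnion, mem_image] at he
      obtain ⟨_, ⟨r, hr, rfl⟩, he⟩ := he
      exact (Finset.mem_filter.mp (Finset.mem_sdiff.mp hr).1).2 e he
    · intro i e he hce
      by_cases h : Sum.inl i ∈ Bad
      · exact absurd (hbadcr _ h e he) hce
      · obtain ⟨h1, h2⟩ := hgood _ h e he
        exact h2.2 ((hJ0m e).2 ⟨⟨i, h1⟩, hce⟩)
    · intro j e he hej
      by_cases h : Sum.inr j ∈ Bad
      · exact hJc e hej (hbadcr _ h e he)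
      · obtain ⟨h1, h2⟩ := hgood _ h e he
        exact hJ0c j e h1 (h2.1 hej)
    · rw [Finset.card_image_of_injective _ Sum.inr_injective]
      have := Finset.le_card_sdiff used Rc
      omega
    · rw [hx]
      change _ = ((2 * (∑ e ∈ J, w e) : ℤ) : ZMod k)
      rw [hJs, htq]
      push_cast
      simp

end PartD3


/-- Tree-connected modulo-`k` factors with degrees bounded away from
`d_G(v)` at every vertex except possibly `z`; the required tree-connectivity is
`m+m₀+4k-4` in general and only `m+m₀+2k-2` when `G` is bipartite. -/
theorem statement_19 [Fintype V] [DecidableEq V] [Fintype E] [DecidableEq E]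
    (ends : E → V × V) (k m m₀ : ℕ) (hk : 2 ≤ k) (z : V)
    (f : V → ZMod k) (hf : Compatible ends (Finset.univ : Finset E) f)
    (hG : TreeConnected ends (m + m₀ + 4 * k - 4) (Finset.univ : Finset E) ∨
      (IsBipartiteG ends (Finset.univ : Finset E) ∧
        TreeConnected ends (m + m₀ + 2 * k - 2) (Finset.univ : Finset E))) :
    ∃ H : Finset E, TreeConnected ends m H ∧
      TreeConnected ends m₀ ((Finset.univ : Finset E) \ H) ∧
      (∀ v, (mdeg ends H v : ZMod k) = f v) ∧
      ∀ v, v ≠ z → (mdeg ends H v : ℤ)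
        ≤ (mdeg ends (Finset.univ : Finset E) v : ℤ) - ((k : ℤ) - 1) := by
  rcases hG with hG | ⟨⟨X, hX⟩, hG⟩
  · exact gen_case ends k m m₀ hk z f hf hG
  · exact bip_case ends k m m₀ hk z f hf X hX hG
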